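/- Under assumptions (A1)–(A3), fix T > 0 and let f : M_1(Z) → ℝ be continuous. Then the mapping ν ↦ Λ(f|ν) := sup_{ξ ∈ M_1(Z)} [ f(ξ) − S_T(ξ|ν) ] is continuous on M_1(Z), and the supremum is attained for each ν. -/

import Mathlib

open MeasureTheory Set ENNReal Filter

noncomputable section

/-- The Legendre conjugate `τ*(u) = (u+1)·log(u+1) − u`.  Since `Real.log 0 = 0`
in Mathlib, this gives `τ*(-1) = 1`, matching the convention of the paper; the
value for `u < -1` is irrelevant since all arguments below are `≥ -1`. -/
def tauStar (u : ℝ) : ℝ := (u + 1) * Real.log (u + 1) - u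

/-- The mean field model: state space `Fin r`, directed edge set `E` without
self-loops, and transition rate functions `lam i j`, together with assumptions
(A1) (irreducibility), (A2) (Lipschitz rates) and (A3) (rates on edges bounded
below by `c > 0`); `Cb` is the upper bound on the rates (a consequence of
(A2) and compactness of the simplex). -/
structure MeanFieldModel (r : ℕ) where
  E : Finset (Fin r × Fin r)
  no_diag : ∀ i : Fin r, (i, i) ∉ E
  /-- (A1): the directed graph `(Z, E)` is irreducible. -/
  irreducible : ∀ i j : Fin r, Relation.ReflTransGen (fun a b => (a, b) ∈ E) i j
  lam : Fin r → Fin r → (Fin r → ℝ) → ℝ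
  /-- (A2): each rate function is Lipschitz on the simplex. -/
  lam_lipschitz : ∀ p ∈ E, ∃ K : NNReal, LipschitzOnWith K (lam p.1 p.2) (stdSimplex ℝ (Fin r))
  c : ℝ
  c_pos : 0 < c
  /-- (A3): rates of admissible jumps are uniformly bounded away from zero. -/
  lam_lower : ∀ p ∈ E, ∀ μ ∈ stdSimplex ℝ (Fin r), c ≤ lam p.1 p.2 μ
  /-- rates vanish off the edge set -/
  lam_off : ∀ i j : Fin r, i ≠ j → (i, j) ∉ E → ∀ μ : Fin r → ℝ, lam i j μ = 0
  /-- diagonal convention `λ_{i,i} = −Σ_{j≠i} λ_{i,j}` -/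
  lam_diag : ∀ i : Fin r, ∀ μ : Fin r → ℝ,
    lam i i μ = -∑ j ∈ Finset.univ.filter (fun j => j ≠ i), lam i j μ
  Cb : ℝ
  /-- upper bound on the rates -/
  lam_upper : ∀ p ∈ E, ∀ μ ∈ stdSimplex ℝ (Fin r), lam p.1 p.2 μ ≤ Cb

variable {r : ℕ}

/-- A time-varying rate matrix `L(t)` adapted to the model: measurable entries,
nonnegative off-diagonal entries, entries vanishing off the edge set, and the
diagonal convention `l_{i,i}(t) = −Σ_{j≠i} l_{i,j}(t)`. -/
def IsRateMatrix (M : MeanFieldModel r) (L : ℝ → Fin r → Fin r → ℝ) : Prop :=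
  (∀ i j : Fin r, Measurable fun t => L t i j) ∧
  (∀ t : ℝ, ∀ i j : Fin r, i ≠ j → 0 ≤ L t i j) ∧
  (∀ t : ℝ, ∀ i j : Fin r, i ≠ j → (i, j) ∉ M.E → L t i j = 0) ∧
  (∀ t : ℝ, ∀ i : Fin r,
    L t i i = -∑ j ∈ Finset.univ.filter (fun j => j ≠ i), L t i j)

/-- `μ` is absolutely continuous on `[0,T]` with `μ̇(t) = L(t)ᵀ μ(t)` a.e.,
expressed in integral form:  `μ(t) = μ(0) + ∫_0^t L(s)ᵀ μ(s) ds`. -/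
def SolvesODE (L : ℝ → Fin r → Fin r → ℝ) (μ : ℝ → Fin r → ℝ) (T : ℝ) : Prop :=
  (∀ i : Fin r, IntegrableOn (fun t => ∑ j, L t j i * μ t j) (Icc 0 T)) ∧
  ∀ t ∈ Icc (0 : ℝ) T, ∀ i : Fin r,
    μ t i = μ 0 i + ∫ s in Ioc (0 : ℝ) t, ∑ j, L s j i * μ s j

/-- `μ` is absolutely continuous on `[0,∞)` with `μ̇(t) = −L(t)ᵀ μ(t)` a.e.
(reversed-time dynamics), in integral form. -/
def SolvesReversedODE (L : ℝ → Fin r → Fin r → ℝ) (μ : ℝ → Fin r → ℝ) : Prop :=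
  (∀ T : ℝ, 0 < T → ∀ i : Fin r,
    IntegrableOn (fun t => ∑ j, L t j i * μ t j) (Icc 0 T)) ∧
  ∀ t : ℝ, 0 ≤ t → ∀ i : Fin r,
    μ t i = μ 0 i - ∫ s in Ioc (0 : ℝ) t, ∑ j, L s j i * μ s j

/-- The running cost
`I_{[0,T]}(μ, L) = ∫_0^T Σ_{(i,j)∈E} μ(t)(i) λ_{i,j}(μ(t)) τ*( l_{i,j}(t)/λ_{i,j}(μ(t)) − 1 ) dt`. -/
def runningCost (M : MeanFieldModel r) (μ : ℝ → Fin r → ℝ)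
    (L : ℝ → Fin r → Fin r → ℝ) (T : ℝ) : ℝ≥0∞ :=
  ∫⁻ t in Ioc (0 : ℝ) T, ENNReal.ofReal (∑ p ∈ M.E,
    μ t p.1 * M.lam p.1 p.2 (μ t) * tauStar (L t p.1 p.2 / M.lam p.1 p.2 (μ t) - 1))

/-- The infinite-horizon running cost on `[0, ∞)`. -/
def runningCostInf (M : MeanFieldModel r) (μ : ℝ → Fin r → ℝ)
    (L : ℝ → Fin r → Fin r → ℝ) : ℝ≥0∞ :=
  ∫⁻ t in Ioi (0 : ℝ), ENNReal.ofReal (∑ p ∈ M.E,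
    μ t p.1 * M.lam p.1 p.2 (μ t) * tauStar (L t p.1 p.2 / M.lam p.1 p.2 (μ t) - 1))

/-- `S_{[0,T]}(μ | ν)`: the infimum of the running cost over all time-varying
rate matrices `L` with `μ̇ = Lᵀ μ` a.e., provided `μ(0) = ν`, `μ` is absolutely
continuous and takes values in `M₁(Z)`; `+∞` otherwise (the infimum over an
empty family being `⊤`). -/
def SPath (M : MeanFieldModel r) (T : ℝ) (ν : Fin r → ℝ) (μ : ℝ → Fin r → ℝ) : ℝ≥0∞ :=
  ⨅ (L : ℝ → Fin r → Fin r → ℝ)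
    (_ : IsRateMatrix M L ∧ SolvesODE L μ T ∧ μ 0 = ν ∧
      ∀ t ∈ Icc (0 : ℝ) T, μ t ∈ stdSimplex ℝ (Fin r)),
    runningCost M μ L T

/-- `S_T(ξ | ν) = inf { S_{[0,T]}(μ|ν) : μ(0) = ν, μ(T) = ξ }`. -/
def SEnd (M : MeanFieldModel r) (T : ℝ) (ν ξ : Fin r → ℝ) : ℝ≥0∞ :=
  ⨅ (μ : ℝ → Fin r → ℝ) (_ : μ 0 = ν ∧ μ T = ξ), SPath M T ν μ

/-- The quasipotential `V(ξ | ν) = inf_{T > 0} S_T(ξ | ν)`. -/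
def quasipotential (M : MeanFieldModel r) (ν ξ : Fin r → ℝ) : ℝ≥0∞ :=
  ⨅ (T : ℝ) (_ : 0 < T), SEnd M T ν ξ

/-- Equivalence of points: `ν ∼ ξ` iff `V(ξ|ν) = V(ν|ξ) = 0`. -/
def VEquiv (M : MeanFieldModel r) (ν ξ : Fin r → ℝ) : Prop :=
  quasipotential M ν ξ = 0 ∧ quasipotential M ξ ν = 0

/-- `s` satisfies the dynamic programming equation
`s(ξ) = inf_{ν ∈ M₁(Z)} [ s(ν) + S_T(ξ|ν) ]` for every `T > 0`. -/
def SatisfiesDPE (M : MeanFieldModel r) (s : (Fin r → ℝ) → ℝ) : Prop :=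
  ∀ T : ℝ, 0 < T → ∀ ξ ∈ stdSimplex ℝ (Fin r),
    ENNReal.ofReal (s ξ) =
      ⨅ ν ∈ stdSimplex ℝ (Fin r), (ENNReal.ofReal (s ν) + SEnd M T ν ξ)

/-- A solution of the McKean–Vlasov equation `μ̇(t) = A_{μ(t)}ᵀ μ(t)` on `[0,∞)`,
as a path in `M₁(Z)`, in integral form. -/
def IsMVSolution (M : MeanFieldModel r) (η : ℝ → Fin r → ℝ) : Prop :=
  (∀ t : ℝ, 0 ≤ t → η t ∈ stdSimplex ℝ (Fin r)) ∧
  (∀ T : ℝ, 0 < T → ∀ i : Fin r,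
    IntegrableOn (fun t => ∑ j, M.lam j i (η t) * η t j) (Icc 0 T)) ∧
  ∀ t : ℝ, 0 ≤ t → ∀ i : Fin r,
    η t i = η 0 i + ∫ s in Ioc (0 : ℝ) t, ∑ j, M.lam j i (η s) * η s j

/-- A solution of the time-reversed McKean–Vlasov equation
`η̇(t) = −A_{η(t)}ᵀ η(t)` on `[0,∞)`, in integral form. -/
def IsReversedMVSolution (M : MeanFieldModel r) (η : ℝ → Fin r → ℝ) : Prop :=
  (∀ T : ℝ, 0 < T → ∀ i : Fin r,
    IntegrableOn (fun t => ∑ j, M.lam j i (η t) * η t j) (Icc 0 T)) ∧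
  ∀ t : ℝ, 0 ≤ t → ∀ i : Fin r,
    η t i = η 0 i - ∫ s in Ioc (0 : ℝ) t, ∑ j, M.lam j i (η s) * η s j

/-- `ξ₀` is the unique globally asymptotically stable equilibrium of the
McKean–Vlasov equation: `A_{ξ₀}ᵀ ξ₀ = 0` and every solution with initial
condition in `M₁(Z)` converges to `ξ₀`. -/
def IsUniqueGASEquilibrium (M : MeanFieldModel r) (ξ₀ : Fin r → ℝ) : Prop :=
  ξ₀ ∈ stdSimplex ℝ (Fin r) ∧
  (∀ i : Fin r, ∑ j, M.lam j i ξ₀ * ξ₀ j = 0) ∧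
  ∀ η : ℝ → Fin r → ℝ, IsMVSolution M η → Tendsto η atTop (nhds ξ₀)

/-- The ω-limit set of a path: `Ω = ∩_{t>0} closure { μ(t') : t' ≥ t }`. -/
def omegaSet (η : ℝ → Fin r → ℝ) : Set (Fin r → ℝ) :=
  ⋂ t ∈ Ioi (0 : ℝ), closure (η '' Ici t)

/-- Assumption (B): finitely many compact subsets `K 1, …, K l` of `M₁(Z)` such
that any two points of the same `K i` are equivalent, no point of `K i` is
equivalent to a point of `M₁(Z)` outside `K i`, and every ω-limit set of the
McKean–Vlasov equation is contained in some `K i`. -/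
def AssumptionB (M : MeanFieldModel r) (l : ℕ) (K : Fin l → Set (Fin r → ℝ)) : Prop :=
  (∀ i, IsCompact (K i)) ∧
  (∀ i, K i ⊆ stdSimplex ℝ (Fin r)) ∧
  (∀ i, ∀ ν ∈ K i, ∀ ξ ∈ K i, VEquiv M ν ξ) ∧
  (∀ i, ∀ ν ∈ K i, ∀ ξ ∈ stdSimplex ℝ (Fin r), ξ ∉ K i → ¬ VEquiv M ν ξ) ∧
  (∀ η : ℝ → Fin r → ℝ, IsMVSolution M η → ∃ i, omegaSet η ⊆ K i)

/-- `μ` is continuous and piecewise linear on `[0,T]`, with constant velocity on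
each linear segment (linear interpolation between the breakpoints). -/
def PiecewiseLinear (μ : ℝ → Fin r → ℝ) (T : ℝ) : Prop :=
  ∃ (n : ℕ) (t : Fin (n + 1) → ℝ), StrictMono t ∧ t 0 = 0 ∧ t (Fin.last n) = T ∧
    ∀ k : Fin n, ∀ u ∈ Icc (t k.castSucc) (t k.succ), ∀ i : Fin r,
      μ u i = μ (t k.castSucc) i +
        (u - t k.castSucc) / (t k.succ - t k.castSucc) *
          (μ (t k.succ) i - μ (t k.castSucc) i)

end

/-! ### Elementary facts on `tauStar` -/

lemma tau_eq (l a : ℝ) (ha : 0 < a) :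
    a * tauStar (l / a - 1) = l * Real.log (l / a) - l + a := by
  unfold tauStar
  field_simp
  ring_nf

lemma tau_young (x θ : ℝ) (hx : 0 ≤ x) : θ * x - (Real.exp θ - 1) ≤ tauStar (x - 1) := by
  unfold tauStar
  rcases hx.eq_or_lt with rfl | hx
  · simp; nlinarith [Real.exp_pos θ]
  · have h := Real.add_one_le_exp (θ - Real.log x)
    rw [Real.exp_sub, Real.exp_log hx] at h
    have h2 := mul_le_mul_of_nonneg_left h hx.le
    have h3 : x * (Real.exp θ / x) = Real.exp θ := by field_simp
    rw [h3] at h2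
    ring_nf at h2 ⊢
    linarith

lemma tau_nonneg (x : ℝ) (hx : 0 ≤ x) : 0 ≤ tauStar (x - 1) := by
  have := tau_young x 0 hx
  simpa using this

lemma tau_dual_zero (g D : ℝ) (hg : 0 ≤ g) (h : ∀ θ : ℝ, θ * g ≤ D) : g = 0 := by
  by_contra hne
  have hpos : 0 < g := lt_of_le_of_ne hg (Ne.symm hne)
  have := h ((D + 1) / g)
  rw [div_mul_cancel₀ _ hne] at this
  linarith

lemma tau_dual (g a D : ℝ) (hg : 0 ≤ g) (ha : 0 < a)
    (h : ∀ θ : ℝ, θ * g - (Real.exp θ - 1) * a ≤ D) : a * tauStar (g / a - 1) ≤ D := by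
  rw [tau_eq _ _ ha]
  rcases hg.eq_or_lt with rfl | hg
  · simp
    refine le_of_forall_pos_lt_add fun ε hε => ?_
    have h1 := h (Real.log (ε / (2 * a)))
    rw [Real.exp_log (by positivity)] at h1
    have : (ε / (2 * a) - 1) * a = ε / 2 - a := by field_simp
    linarith
  · have h1 := h (Real.log (g / a))
    rw [Real.exp_log (by positivity)] at h1
    have : (g / a - 1) * a = g - a := by field_simp
    linarith

/-! ### Sums of increments, absolute continuity -/

lemma sum_incr_le (H : ℝ → ℝ) (x y : ℕ → ℝ) (a : ℝ) (S : Finset ℕ) :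
    ∀ b, a ≤ b → MonotoneOn H (Icc a b) → (∀ i ∈ S, a ≤ x i ∧ x i ≤ y i ∧ y i ≤ b) →
      (S : Set ℕ).PairwiseDisjoint (fun i => Ioc (x i) (y i)) →
      ∑ i ∈ S, (H (y i) - H (x i)) ≤ H b - H a := by
  induction S using Finset.induction_on_max_value x with
  | empty =>
    intro b hab hH _ _
    simpa using hH (left_mem_Icc.2 hab) (right_mem_Icc.2 hab) hab
  | insert j s hj hmax ih =>
    intro b hab hH hS hd
    rw [Finset.sum_insert hj]
    have hS' : ∀ i ∈ s, a ≤ x i ∧ x i ≤ y i ∧ y i ≤ b := fun i hi => hS i (by simp [hi])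
    have hd' : (s : Set ℕ).PairwiseDisjoint (fun i => Ioc (x i) (y i)) :=
      hd.subset (by simp)
    obtain ⟨h1, h2, h3⟩ := hS j (by simp)
    rcases h2.eq_or_lt with h2 | h2
    · rw [← h2]
      simpa using ih b hab hH hS' hd'
    · have h4 : ∀ i ∈ s, y i ≤ x j := by
        intro i hi
        by_contra! hlt
        have hne : i ≠ j := fun h => hj (h ▸ hi)
        have hdis := hd (by simp [hi]) (by simp) hne
        refine Set.disjoint_left.1 hdis (?_ : min (y i) (y j) ∈ _) ?_
        · exact ⟨lt_of_le_of_lt (hmax i hi) (lt_min hlt h2), min_le_left _ _⟩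
        · exact ⟨lt_min hlt h2, min_le_right _ _⟩
      have h5 := ih (x j) h1 (hH.mono (Icc_subset_Icc le_rfl (h2.le.trans h3)))
        (fun i hi => ⟨(hS' i hi).1, (hS' i hi).2.1, h4 i hi⟩) hd'
      have h6 := hH ⟨h1.trans h2.le, h3⟩ (right_mem_Icc.2 hab) h3
      linarith

lemma ac_of_bound (T : ℝ) (hT : 0 < T) (G H : ℝ → ℝ) (C : ℝ)
    (hG : MonotoneOn G (Icc 0 T)) (hH : MonotoneOn H (Icc 0 T))
    (hGH : ∀ θ : ℝ, 0 ≤ θ → ∀ s ∈ Icc 0 T, ∀ t ∈ Icc 0 T, s ≤ t →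
      θ * (G t - G s) ≤ H t - H s + (Real.exp θ - 1) * C * (t - s)) :
    AbsolutelyContinuousOnInterval G 0 T := by
  rw [absolutelyContinuousOnInterval_iff]
  intro ε hε
  have hH0 : 0 ≤ H T - H 0 := by
    have := hH (left_mem_Icc.2 hT.le) (right_mem_Icc.2 hT.le) hT.le
    linarith
  set θ : ℝ := (H T - H 0 + 1) / ε with hθ
  have hθ0 : 0 < θ := by positivity
  set N := |(Real.exp θ - 1) * C| + 1 with hN
  have hN0 : 0 < N := by positivity
  refine ⟨1 / N, by positivity, ?_⟩
  rintro ⟨n, I⟩ hI hlen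
  obtain ⟨hI1, hI2⟩ := hI
  simp only [uIcc_of_le hT.le] at hI1 hI2 hlen ⊢
  have hkey : θ * ∑ i ∈ Finset.range n, dist (G (I i).1) (G (I i).2) ≤
      ∑ i ∈ Finset.range n, (H (max (I i).1 (I i).2) - H (min (I i).1 (I i).2)) +
        N * ∑ i ∈ Finset.range n, dist (I i).1 (I i).2 := by
    rw [Finset.mul_sum, Finset.mul_sum, ← Finset.sum_add_distrib]
    refine Finset.sum_le_sum fun i hi => ?_
    obtain ⟨ha, hb⟩ := hI1 i hi
    have aux : ∀ s ∈ Icc 0 T, ∀ t ∈ Icc 0 T, s ≤ t →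
        θ * (G t - G s) ≤ H t - H s + N * (t - s) := by
      intro s hs t ht hst
      refine (hGH θ hθ0.le s hs t ht hst).trans ?_
      have : (Real.exp θ - 1) * C ≤ N := (le_abs_self _).trans (by linarith)
      have := mul_le_mul_of_nonneg_right this (sub_nonneg.2 hst)
      linarith
    rcases le_total (I i).1 (I i).2 with h | h
    · rw [max_eq_right h, min_eq_left h, dist_comm, Real.dist_eq,
        abs_of_nonneg (sub_nonneg.2 (hG ha hb h)), dist_comm, Real.dist_eq,
        abs_of_nonneg (sub_nonneg.2 h)]
      exact aux _ ha _ hb h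
    · rw [max_eq_left h, min_eq_right h, Real.dist_eq,
        abs_of_nonneg (sub_nonneg.2 (hG hb ha h)), Real.dist_eq,
        abs_of_nonneg (sub_nonneg.2 h)]
      exact aux _ hb _ ha h
  have hsum : ∑ i ∈ Finset.range n, (H (max (I i).1 (I i).2) - H (min (I i).1 (I i).2))
      ≤ H T - H 0 := by
    refine sum_incr_le H (fun i => min (I i).1 (I i).2) (fun i => max (I i).1 (I i).2) 0
      (Finset.range n) T hT.le hH ?_ ?_
    · intro i hi
      obtain ⟨ha, hb⟩ := hI1 i hi
      exact ⟨le_min ha.1 hb.1, min_le_max, max_le ha.2 hb.2⟩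
    · exact hI2
  have hlt : N * ∑ i ∈ Finset.range n, dist (I i).1 (I i).2 < 1 := by
    have := mul_lt_mul_of_pos_left hlen hN0
    rwa [mul_one_div_cancel hN0.ne'] at this
  have hfin : θ * ∑ i ∈ Finset.range n, dist (G (I i).1) (G (I i).2) < θ * ε := by
    have : θ * ε = H T - H 0 + 1 := by rw [hθ]; field_simp
    linarith
  exact lt_of_mul_lt_mul_left hfin hθ0.le

/-! ### The relaxed (closed) formulation -/

abbrev PathSp (r : ℕ) : Type :=
  (ℝ → Fin r → ℝ) × (Fin r × Fin r → ℝ → ℝ) × (Fin r × Fin r → ℝ → ℝ)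

def inc {r : ℕ} (p : Fin r × Fin r) (i : Fin r) : ℝ :=
  (if p.2 = i then 1 else 0) - (if p.1 = i then 1 else 0)

structure Adm {r : ℕ} (M : MeanFieldModel r) (lt : Fin r × Fin r → (Fin r → ℝ) → ℝ)
    (C T k : ℝ) (x : PathSp r) : Prop where
  mem : ∀ t, x.1 t ∈ stdSimplex ℝ (Fin r)
  Gbox : ∀ p t, x.2.1 p t ∈ Icc 0 (k + 2 * |M.Cb| * T)
  Hbox : ∀ p t, x.2.2 p t ∈ Icc 0 k
  HT : ∑ p ∈ M.E, x.2.2 p T ≤ k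
  G0 : ∀ p ∈ M.E, x.2.1 p 0 = 0
  bal : ∀ t ∈ Icc 0 T, ∀ i, x.1 t i = x.1 0 i + ∑ p ∈ M.E, x.2.1 p t * inc p i
  mono : ∀ p ∈ M.E, ∀ s ∈ Icc 0 T, ∀ t ∈ Icc 0 T, s ≤ t → x.2.1 p s ≤ x.2.1 p t
  loc : ∀ p ∈ M.E, ∀ θ : ℝ, ∀ s ∈ Icc 0 T, ∀ t ∈ Icc 0 T, s ≤ t →
    θ * (x.2.1 p t - x.2.1 p s) - ((Real.exp θ - 1) * (x.1 s p.1 * lt p (x.1 s)) +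
      |Real.exp θ - 1| * (C * ∑ q ∈ M.E, (x.2.1 q t - x.2.1 q s))) * (t - s)
      ≤ x.2.2 p t - x.2.2 p s
  ac : ∀ p ∈ M.E, ∀ θ : ℝ, 0 ≤ θ → ∀ s ∈ Icc 0 T, ∀ t ∈ Icc 0 T, s ≤ t →
    θ * (x.2.1 p t - x.2.1 p s) ≤ x.2.2 p t - x.2.2 p s + (Real.exp θ - 1) * M.Cb * (t - s)

lemma isClosed_all {X : Type*} [TopologicalSpace X] {ι : Sort*} {P : ι → X → Prop}
    (h : ∀ i, IsClosed {x | P i x}) : IsClosed {x | ∀ i, P i x} := by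
  have : {x | ∀ i, P i x} = ⋂ i, {x | P i x} := by ext; simp
  rw [this]
  exact isClosed_iInter h

lemma adm_isCompact {r : ℕ} (M : MeanFieldModel r) (lt : Fin r × Fin r → (Fin r → ℝ) → ℝ)
    (hlt : ∀ p, Continuous (lt p)) (C T k : ℝ) : IsCompact {x | Adm M lt C T k x} := by
  have hbox : IsCompact ((univ.pi fun _ : ℝ => stdSimplex ℝ (Fin r)) ×ˢ
      (univ.pi fun _ : Fin r × Fin r => univ.pi fun _ : ℝ => Icc 0 (k + 2 * |M.Cb| * T)) ×ˢ
      (univ.pi fun _ : Fin r × Fin r => univ.pi fun _ : ℝ => Icc 0 k) : Set (PathSp r)) := by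
    refine (isCompact_univ_pi fun _ => isCompact_stdSimplex ℝ _).prod
      ((isCompact_univ_pi fun _ => isCompact_univ_pi fun _ => isCompact_Icc).prod
      (isCompact_univ_pi fun _ => isCompact_univ_pi fun _ => isCompact_Icc))
  refine hbox.of_isClosed_subset ?_ ?_
  · have : {x | Adm M lt C T k x} = {x : PathSp r |
        (∀ t, x.1 t ∈ stdSimplex ℝ (Fin r))} ∩ ({x : PathSp r |
        (∀ p t, x.2.1 p t ∈ Icc 0 (k + 2 * |M.Cb| * T))} ∩ ({x : PathSp r |
        (∀ p t, x.2.2 p t ∈ Icc 0 k)} ∩ ({x : PathSp r |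
        (∑ p ∈ M.E, x.2.2 p T ≤ k)} ∩ ({x : PathSp r |
        (∀ p ∈ M.E, x.2.1 p 0 = 0)} ∩ ({x : PathSp r |
        (∀ t ∈ Icc 0 T, ∀ i, x.1 t i = x.1 0 i + ∑ p ∈ M.E, x.2.1 p t * inc p i)} ∩ ({x : PathSp r |
        (∀ p ∈ M.E, ∀ s ∈ Icc 0 T, ∀ t ∈ Icc 0 T, s ≤ t → x.2.1 p s ≤ x.2.1 p t)} ∩
        ({x : PathSp r | (∀ p ∈ M.E, ∀ θ : ℝ, ∀ s ∈ Icc 0 T, ∀ t ∈ Icc 0 T, s ≤ t →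
          θ * (x.2.1 p t - x.2.1 p s) - ((Real.exp θ - 1) * (x.1 s p.1 * lt p (x.1 s)) +
          |Real.exp θ - 1| * (C * ∑ q ∈ M.E, (x.2.1 q t - x.2.1 q s))) * (t - s)
          ≤ x.2.2 p t - x.2.2 p s)} ∩ {x : PathSp r |
        (∀ p ∈ M.E, ∀ θ : ℝ, 0 ≤ θ → ∀ s ∈ Icc 0 T, ∀ t ∈ Icc 0 T, s ≤ t →
          θ * (x.2.1 p t - x.2.1 p s) ≤ x.2.2 p t - x.2.2 p s +
            (Real.exp θ - 1) * M.Cb * (t - s))}))))))) := by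
      ext x
      constructor
      · intro h
        exact ⟨h.mem, h.Gbox, h.Hbox, h.HT, h.G0, h.bal, h.mono, h.loc, h.ac⟩
      · rintro ⟨h1, h2, h3, h4, h5, h6, h7, h8, h9⟩
        exact ⟨h1, h2, h3, h4, h5, h6, h7, h8, h9⟩
    rw [this]
    have c1 : ∀ t : ℝ, Continuous fun x : PathSp r => x.1 t := fun t => by fun_prop
    have c1' : ∀ (t : ℝ) (i : Fin r), Continuous fun x : PathSp r => x.1 t i := fun t i => by fun_prop
    have c2 : ∀ p (t : ℝ), Continuous fun x : PathSp r => x.2.1 p t := fun p t => by fun_prop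
    have c3 : ∀ p (t : ℝ), Continuous fun x : PathSp r => x.2.2 p t := fun p t => by fun_prop
    have c4 : ∀ p (t : ℝ), Continuous fun x : PathSp r => lt p (x.1 t) :=
      fun p t => (hlt p).comp (c1 t)
    refine IsClosed.inter ?_ <| IsClosed.inter ?_ <| IsClosed.inter ?_ <| IsClosed.inter ?_ <|
      IsClosed.inter ?_ <| IsClosed.inter ?_ <| IsClosed.inter ?_ <| IsClosed.inter ?_ ?_
    · exact isClosed_all fun t => (isClosed_stdSimplex ℝ (Fin r)).preimage (c1 t)
    · exact isClosed_all fun p => isClosed_all fun t => isClosed_Icc.preimage (c2 p t)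
    · exact isClosed_all fun p => isClosed_all fun t => isClosed_Icc.preimage (c3 p t)
    · exact isClosed_le (by fun_prop) (by fun_prop)
    · exact isClosed_all fun p => isClosed_all fun _ => isClosed_eq (by fun_prop) (by fun_prop)
    · exact isClosed_all fun t => isClosed_all fun _ => isClosed_all fun i =>
        isClosed_eq (by fun_prop) (by fun_prop)
    · exact isClosed_all fun p => isClosed_all fun _ => isClosed_all fun s => isClosed_all fun _ =>
        isClosed_all fun t => isClosed_all fun _ => isClosed_all fun _ =>
        isClosed_le (by fun_prop) (by fun_prop)
    · exact isClosed_all fun p => isClosed_all fun _ => isClosed_all fun θ =>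
        isClosed_all fun s => isClosed_all fun _ =>
        isClosed_all fun t => isClosed_all fun _ => isClosed_all fun _ =>
        isClosed_le (by fun_prop) (by fun_prop)
    · exact isClosed_all fun p => isClosed_all fun _ => isClosed_all fun θ =>
        isClosed_all fun _ => isClosed_all fun s => isClosed_all fun _ =>
        isClosed_all fun t => isClosed_all fun _ => isClosed_all fun _ =>
        isClosed_le (by fun_prop) (by fun_prop)
  · intro x hx
    exact ⟨fun t _ => hx.mem t, fun p _ t _ => hx.Gbox p t, fun p _ t _ => hx.Hbox p t⟩

lemma adm_closed {r : ℕ} (M : MeanFieldModel r) (lt : Fin r × Fin r → (Fin r → ℝ) → ℝ)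
    (hlt : ∀ p, Continuous (lt p)) (C T k : ℝ) :
    IsClosed {z : (Fin r → ℝ) × (Fin r → ℝ) | ∃ x, Adm M lt C T k x ∧ x.1 0 = z.1 ∧ x.1 T = z.2} := by
  have h := ((adm_isCompact M lt hlt C T k).image
    (f := fun x : PathSp r => (x.1 0, x.1 T)) (by fun_prop)).isClosed
  convert h using 1
  ext ⟨a, b⟩
  simp [Prod.ext_iff]

/-! ### From a controlled path to the relaxed formulation -/

lemma flux_id {r : ℕ} (M : MeanFieldModel r) (A : Fin r → Fin r → ℝ) (m : Fin r → ℝ)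
    (hoff : ∀ i j : Fin r, i ≠ j → (i, j) ∉ M.E → A i j = 0)
    (hdiag : ∀ i : Fin r, A i i = -∑ j ∈ Finset.univ.filter (fun j => j ≠ i), A i j) (i : Fin r) :
    ∑ j, A j i * m j = ∑ p ∈ M.E, (m p.1 * A p.1 p.2) * inc p i := by
  have h1 : ∑ p ∈ M.E, (m p.1 * A p.1 p.2) * inc p i =
      ∑ p : Fin r × Fin r, (m p.1 * A p.1 p.2) * inc p i := by
    refine Finset.sum_subset (Finset.subset_univ _) fun p _ hp => ?_
    by_cases h : p.1 = p.2
    · simp [inc, h]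
    · rw [hoff p.1 p.2 h hp]; simp
  have hrow : ∑ b, A i b = 0 := by
    rw [← Finset.add_sum_erase _ _ (Finset.mem_univ i), hdiag i,
      ← Finset.filter_ne' Finset.univ i]
    simp
  rw [h1, Fintype.sum_prod_type]
  simp only [inc, mul_sub, mul_ite, mul_one, mul_zero, Finset.sum_sub_distrib]
  have h2 : ∑ x, ∑ y, (if x = i then m x * A x y else 0) = 0 := by
    rw [Finset.sum_eq_single i]
    · simp [← Finset.mul_sum, hrow]
    · intro b _ hb; simp [hb]
    · simp
  rw [h2]
  simp [mul_comm]

lemma abs_inc_le {r : ℕ} (p : Fin r × Fin r) (i : Fin r) : |inc p i| ≤ 1 := by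
  unfold inc; split_ifs <;> simp

lemma simplex_le_one {r : ℕ} {m : Fin r → ℝ} (hm : m ∈ stdSimplex ℝ (Fin r)) (i : Fin r) :
    m i ≤ 1 := by
  rw [← hm.2]
  exact Finset.single_le_sum (fun j _ => hm.1 j) (Finset.mem_univ i)

structure RateExt {r : ℕ} (M : MeanFieldModel r) (lt : Fin r × Fin r → (Fin r → ℝ) → ℝ)
    (K : NNReal) : Prop where
  lip : ∀ p, LipschitzWith K (lt p)
  eq : ∀ p ∈ M.E, ∀ m ∈ stdSimplex ℝ (Fin r), M.lam p.1 p.2 m = lt p m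

lemma exists_ext {r : ℕ} (M : MeanFieldModel r) : ∃ lt K, RateExt M lt K := by
  have h : ∀ p : Fin r × Fin r, ∃ (K : NNReal) (g : (Fin r → ℝ) → ℝ), LipschitzWith K g ∧
      (p ∈ M.E → EqOn (M.lam p.1 p.2) g (stdSimplex ℝ (Fin r))) := by
    intro p
    by_cases hp : p ∈ M.E
    · obtain ⟨K, hK⟩ := M.lam_lipschitz p hp
      obtain ⟨g, hg, hg'⟩ := hK.extend_real
      exact ⟨K, g, hg, fun _ => hg'⟩
    · exact ⟨0, fun _ => 0, LipschitzWith.const 0, fun h => absurd h hp⟩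
  choose K g hg hg' using h
  refine ⟨g, ∑ p, K p, ⟨fun p => (hg p).weaken ?_, fun p hp m hm => hg' p hp hm⟩⟩
  exact Finset.single_le_sum (f := K) (fun _ _ => zero_le) (Finset.mem_univ p)

lemma RateExt.pos {r : ℕ} {M : MeanFieldModel r} {lt K} (h : RateExt M lt K) {p} (hp : p ∈ M.E)
    {m} (hm : m ∈ stdSimplex ℝ (Fin r)) : M.c ≤ lt p m ∧ 0 < lt p m ∧ lt p m ≤ M.Cb := by
  rw [← h.eq p hp m hm]
  exact ⟨M.lam_lower p hp m hm, M.c_pos.trans_le (M.lam_lower p hp m hm), M.lam_upper p hp m hm⟩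

lemma RateExt.a_bd {r : ℕ} {M : MeanFieldModel r} {lt K} (h : RateExt M lt K) {p} (hp : p ∈ M.E)
    {m} (hm : m ∈ stdSimplex ℝ (Fin r)) : 0 ≤ m p.1 * lt p m ∧ m p.1 * lt p m ≤ M.Cb := by
  obtain ⟨h1, h2, h3⟩ := h.pos hp hm
  exact ⟨mul_nonneg (hm.1 _) h2.le,
    (mul_le_mul_of_nonneg_right (simplex_le_one hm p.1) h2.le).trans (by simpa using h3)⟩

lemma RateExt.a_lip {r : ℕ} {M : MeanFieldModel r} {lt K} (h : RateExt M lt K) {p} (hp : p ∈ M.E)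
    {m m' : Fin r → ℝ} (hm : m ∈ stdSimplex ℝ (Fin r)) (hm' : m' ∈ stdSimplex ℝ (Fin r)) :
    |m p.1 * lt p m - m' p.1 * lt p m'| ≤ (|M.Cb| + K) * dist m m' := by
  have e : m p.1 * lt p m - m' p.1 * lt p m' =
      (m p.1 - m' p.1) * lt p m + m' p.1 * (lt p m - lt p m') := by ring
  rw [e]
  obtain ⟨h1, h2, h3⟩ := h.pos hp hm
  refine (abs_add_le _ _).trans ?_
  rw [abs_mul, abs_mul, abs_of_pos h2, abs_of_nonneg (hm'.1 p.1), add_mul]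
  have d1 : |m p.1 - m' p.1| ≤ dist m m' := by
    rw [← Real.dist_eq]; exact dist_le_pi_dist m m' p.1
  have d2 : |lt p m - lt p m'| ≤ K * dist m m' := by
    rw [← Real.dist_eq]; exact (h.lip p).dist_le_mul m m'
  refine add_le_add ?_ ?_
  · rw [mul_comm]
    exact mul_le_mul (h3.trans (le_abs_self _)) d1 (abs_nonneg _) (abs_nonneg _)
  · calc m' p.1 * |lt p m - lt p m'| ≤ 1 * |lt p m - lt p m'| :=
        mul_le_mul_of_nonneg_right (simplex_le_one hm' p.1) (abs_nonneg _)
      _ ≤ _ := by simpa using d2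

lemma ode_continuousOn {r : ℕ} {L : ℝ → Fin r → Fin r → ℝ} {μ : ℝ → Fin r → ℝ} {T : ℝ}
    (h : SolvesODE L μ T) : ContinuousOn μ (Icc 0 T) := by
  rw [continuousOn_pi]
  intro i
  have h1 := intervalIntegral.continuousOn_primitive (h.1 i)
  exact (continuousOn_const.add h1).congr fun t ht => h.2 t ht i

lemma measurable_tau : Measurable tauStar := by
  unfold tauStar
  fun_prop

lemma forward {r : ℕ} {M : MeanFieldModel r} {lt K} (he : RateExt M lt K) {T k : ℝ} (hT : 0 < T)
    {L : ℝ → Fin r → Fin r → ℝ} {μ : ℝ → Fin r → ℝ} (hL : IsRateMatrix M L)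
    (hode : SolvesODE L μ T) (hμ : ∀ t ∈ Icc (0 : ℝ) T, μ t ∈ stdSimplex ℝ (Fin r))
    (hk : runningCost M μ L T < ENNReal.ofReal k) :
    ∃ x, Adm M lt (|M.Cb| + K) T k x ∧ x.1 0 = μ 0 ∧ x.1 T = μ T := by
  obtain ⟨hL1, hL2, hL3, hL4⟩ := hL
  have hk0 : 0 < k := by
    by_contra! h
    rw [ENNReal.ofReal_of_nonpos h] at hk
    exact absurd hk (by simp)
  set cl : ℝ → ℝ := fun t => max 0 (min t T) with hcl
  have clmem : ∀ t, cl t ∈ Icc 0 T := fun t => ⟨le_max_left _ _, max_le hT.le (min_le_right _ _)⟩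
  have cleq : ∀ t ∈ Icc 0 T, cl t = t := by
    intro t ht
    simp [hcl, ht.1, ht.2]
  have clcont : Continuous cl := by fun_prop
  set m : ℝ → Fin r → ℝ := fun t => μ (cl t) with hm
  have mcont : Continuous m := (ode_continuousOn hode).comp_continuous clcont clmem
  have mmem : ∀ t, m t ∈ stdSimplex ℝ (Fin r) := fun t => hμ _ (clmem t)
  have meq : ∀ t ∈ Icc 0 T, m t = μ t := fun t ht => by rw [hm]; simp only [cleq t ht]
  set a : Fin r × Fin r → ℝ → ℝ := fun p s => m s p.1 * lt p (m s) with ha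
  set g : Fin r × Fin r → ℝ → ℝ := fun p s => m s p.1 * L s p.1 p.2 with hg
  set h : Fin r × Fin r → ℝ → ℝ :=
    fun p s => m s p.1 * lt p (m s) * tauStar (L s p.1 p.2 / lt p (m s) - 1) with hh
  have mmeas : ∀ i, Measurable fun s => m s i := fun i =>
    ((continuous_apply i).comp mcont).measurable
  have ltmeas : ∀ p, Measurable fun s => lt p (m s) := fun p =>
    ((he.lip p).continuous.comp mcont).measurable
  have gmeas : ∀ p, Measurable (g p) := fun p => (mmeas p.1).mul (hL1 p.1 p.2)
  have hmeas : ∀ p, Measurable (h p) := fun p => ((mmeas p.1).mul (ltmeas p)).mul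
    (measurable_tau.comp (((hL1 p.1 p.2).div (ltmeas p)).sub_const 1))
  have hne : ∀ p ∈ M.E, p.1 ≠ p.2 := fun p hp heq => M.no_diag p.1 (by
    have : (p.1, p.1) = p := Prod.ext rfl heq
    rwa [this])
  have Lnn : ∀ p ∈ M.E, ∀ s, 0 ≤ L s p.1 p.2 := fun p hp s => hL2 s _ _ (hne p hp)
  have gnn : ∀ p ∈ M.E, ∀ s, 0 ≤ g p s := fun p hp s => mul_nonneg ((mmem s).1 _) (Lnn p hp s)
  have hnn : ∀ p ∈ M.E, ∀ s, 0 ≤ h p s := fun p hp s =>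
    mul_nonneg (he.a_bd hp (mmem s)).1
      (tau_nonneg _ (div_nonneg (Lnn p hp s) (he.pos hp (mmem s)).2.1.le))
  have young : ∀ p ∈ M.E, ∀ θ s, θ * g p s - (Real.exp θ - 1) * a p s ≤ h p s := by
    intro p hp θ s
    have hpos := (he.pos hp (mmem s)).2.1
    have h1 := tau_young (L s p.1 p.2 / lt p (m s)) θ (div_nonneg (Lnn p hp s) hpos.le)
    have h2 := mul_le_mul_of_nonneg_left h1 (he.a_bd hp (mmem s)).1
    refine le_trans (le_of_eq ?_) h2
    simp only [hg, ha]
    field_simp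
  -- integrability
  have hcost : ∫⁻ s in Ioc 0 T, ENNReal.ofReal (∑ p ∈ M.E, h p s) < ENNReal.ofReal k := by
    refine lt_of_eq_of_lt ?_ hk
    unfold runningCost
    refine setLIntegral_congr_fun measurableSet_Ioc fun s hs => ?_
    have hs' : s ∈ Icc 0 T := ⟨hs.1.le, hs.2⟩
    refine congrArg ENNReal.ofReal (Finset.sum_congr rfl fun p hp => ?_)
    simp only [hh]
    rw [← he.eq p hp _ (mmem s), meq s hs']
  have sint : IntegrableOn (fun s => ∑ p ∈ M.E, h p s) (Ioc 0 T) := by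
    refine ⟨(Finset.measurable_sum _ fun p _ => hmeas p).aestronglyMeasurable, ?_⟩
    rw [hasFiniteIntegral_iff_ofReal (Eventually.of_forall fun s =>
      Finset.sum_nonneg fun p hp => hnn p hp s)]
    exact hcost.trans ENNReal.ofReal_lt_top
  have hint : ∀ p ∈ M.E, IntegrableOn (h p) (Ioc 0 T) := by
    intro p hp
    refine Integrable.mono' sint (hmeas p).aestronglyMeasurable (Eventually.of_forall fun s => ?_)
    rw [Real.norm_eq_abs, abs_of_nonneg (hnn p hp s)]
    exact Finset.single_le_sum (f := fun p => h p s) (fun q hq => hnn q hq s) hp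
  have gint : ∀ p ∈ M.E, IntegrableOn (g p) (Ioc 0 T) := by
    intro p hp
    have hc : IntegrableOn (fun _ : ℝ => (Real.exp 1 - 1) * M.Cb) (Ioc 0 T) :=
      integrableOn_const (by simp)
    refine Integrable.mono' ((hint p hp).add hc) (gmeas p).aestronglyMeasurable
      (Eventually.of_forall fun s => ?_)
    rw [Real.norm_eq_abs, abs_of_nonneg (gnn p hp s)]
    have h1 := young p hp 1 s
    have h2 := mul_le_mul_of_nonneg_left (he.a_bd hp (mmem s)).2
      (by have := Real.add_one_le_exp 1; linarith : 0 ≤ Real.exp 1 - 1)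
    simp only [Pi.add_apply]
    simp only [ha] at h1
    linarith
  have hII : ∀ p ∈ M.E, ∀ s ∈ Icc 0 T, ∀ t ∈ Icc 0 T, IntervalIntegrable (h p) volume s t := by
    intro p hp s hs t ht
    have : IntervalIntegrable (h p) volume 0 T :=
      (intervalIntegrable_iff_integrableOn_Ioc_of_le hT.le).2 (hint p hp)
    exact this.mono_set (by rw [uIcc_of_le hT.le]; exact uIcc_subset_Icc hs ht)
  have gII : ∀ p ∈ M.E, ∀ s ∈ Icc 0 T, ∀ t ∈ Icc 0 T, IntervalIntegrable (g p) volume s t := by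
    intro p hp s hs t ht
    have : IntervalIntegrable (g p) volume 0 T :=
      (intervalIntegrable_iff_integrableOn_Ioc_of_le hT.le).2 (gint p hp)
    exact this.mono_set (by rw [uIcc_of_le hT.le]; exact uIcc_subset_Icc hs ht)
  have z0 : (0 : ℝ) ∈ Icc 0 T := left_mem_Icc.2 hT.le
  have zT : T ∈ Icc 0 T := right_mem_Icc.2 hT.le
  set G : Fin r × Fin r → ℝ → ℝ := fun p t => if p ∈ M.E then ∫ s in (0 : ℝ)..cl t, g p s else 0
    with hG
  set H : Fin r × Fin r → ℝ → ℝ := fun p t => if p ∈ M.E then ∫ s in (0 : ℝ)..cl t, h p s else 0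
    with hH
  have Ginc : ∀ p ∈ M.E, ∀ s ∈ Icc 0 T, ∀ t ∈ Icc 0 T, G p t - G p s = ∫ u in s..t, g p u := by
    intro p hp s hs t ht
    simp only [hG, hp, if_true, cleq s hs, cleq t ht]
    rw [intervalIntegral.integral_interval_sub_left (gII p hp _ z0 _ ht) (gII p hp _ z0 _ hs)]
  have Hinc : ∀ p ∈ M.E, ∀ s ∈ Icc 0 T, ∀ t ∈ Icc 0 T, H p t - H p s = ∫ u in s..t, h p u := by
    intro p hp s hs t ht
    simp only [hH, hp, if_true, cleq s hs, cleq t ht]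
    rw [intervalIntegral.integral_interval_sub_left (hII p hp _ z0 _ ht) (hII p hp _ z0 _ hs)]
  have Gmono : ∀ p ∈ M.E, ∀ s ∈ Icc 0 T, ∀ t ∈ Icc 0 T, s ≤ t → G p s ≤ G p t := by
    intro p hp s hs t ht hst
    have := Ginc p hp s hs t ht
    have h2 := intervalIntegral.integral_nonneg (μ := volume) hst (fun u _ => gnn p hp u)
    linarith
  have Hmono : ∀ p ∈ M.E, ∀ s ∈ Icc 0 T, ∀ t ∈ Icc 0 T, s ≤ t → H p s ≤ H p t := by
    intro p hp s hs t ht hst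
    have := Hinc p hp s hs t ht
    have h2 := intervalIntegral.integral_nonneg (μ := volume) hst (fun u _ => hnn p hp u)
    linarith
  have Gcl : ∀ p t, G p t = G p (cl t) := by
    intro p t
    simp only [hG]
    rw [cleq _ (clmem t)]
  have Hcl : ∀ p t, H p t = H p (cl t) := by
    intro p t
    simp only [hH]
    rw [cleq _ (clmem t)]
  have G0 : ∀ p, G p 0 = 0 := by
    intro p; simp [hG, cleq 0 z0]
  have H0 : ∀ p, H p 0 = 0 := by
    intro p; simp [hH, cleq 0 z0]
  have HT : ∑ p ∈ M.E, H p T ≤ k := by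
    have e1 : ∑ p ∈ M.E, H p T = ∫ s in Ioc 0 T, ∑ p ∈ M.E, h p s := by
      rw [integral_finsetSum _ hint]
      refine Finset.sum_congr rfl fun p hp => ?_
      simp only [hH, hp, if_true, cleq T zT]
      rw [intervalIntegral.integral_of_le hT.le]
    rw [e1, integral_eq_lintegral_of_nonneg_ae (Eventually.of_forall fun s =>
      Finset.sum_nonneg fun p hp => hnn p hp s) sint.1]
    exact ENNReal.toReal_le_of_le_ofReal hk0.le hcost.le
  have HTnn : ∀ p ∈ M.E, 0 ≤ H p T := fun p hp => by
    have := Hmono p hp 0 z0 T zT hT.le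
    rwa [H0] at this
  have ac : ∀ p ∈ M.E, ∀ θ : ℝ, 0 ≤ θ → ∀ s ∈ Icc 0 T, ∀ t ∈ Icc 0 T, s ≤ t →
      θ * (G p t - G p s) ≤ H p t - H p s + (Real.exp θ - 1) * M.Cb * (t - s) := by
    intro p hp θ hθ s hs t ht hst
    rw [Ginc p hp s hs t ht, Hinc p hp s hs t ht, ← intervalIntegral.integral_const_mul]
    have e : (Real.exp θ - 1) * M.Cb * (t - s) = ∫ _ in s..t, (Real.exp θ - 1) * M.Cb := by
      rw [intervalIntegral.integral_const, smul_eq_mul, mul_comm]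
    rw [e, ← intervalIntegral.integral_add (hII p hp s hs t ht) (by simp)]
    refine intervalIntegral.integral_mono_on hst ((gII p hp s hs t ht).const_mul θ)
      ((hII p hp s hs t ht).add (by simp)) fun u _ => ?_
    have h1 := young p hp θ u
    have h2 := mul_le_mul_of_nonneg_left (he.a_bd hp (mmem u)).2
      (by have := Real.add_one_le_exp θ; linarith : 0 ≤ Real.exp θ - 1)
    simp only [ha] at h1
    linarith
  have Hle : ∀ p ∈ M.E, H p T ≤ k := fun p hp =>
    (Finset.single_le_sum (f := fun p => H p T) HTnn hp).trans HT
  have bal : ∀ t ∈ Icc 0 T, ∀ i, m t i = m 0 i + ∑ p ∈ M.E, G p t * inc p i := by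
    intro t ht i
    rw [meq t ht, meq 0 z0, hode.2 t ht i]
    congr 1
    have e1 : ∫ s in Ioc 0 t, ∑ j, L s j i * μ s j =
        ∫ s in Ioc 0 t, ∑ p ∈ M.E, g p s * inc p i := by
      refine setIntegral_congr_fun measurableSet_Ioc fun s hs => ?_
      have hs' : s ∈ Icc 0 T := ⟨hs.1.le, hs.2.trans ht.2⟩
      simp only [hg]
      rw [← flux_id M (L s) (m s) (hL3 s) (hL4 s) i, meq s hs']
    rw [e1, integral_finsetSum]
    · refine Finset.sum_congr rfl fun p hp => ?_
      rw [integral_mul_const]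
      simp only [hG, hp, if_true, cleq t ht]
      rw [intervalIntegral.integral_of_le ht.1]
    · intro p hp
      exact ((gint p hp).mono_set (Ioc_subset_Ioc le_rfl ht.2)).mul_const _
  refine ⟨(m, G, H), ⟨mmem, ?_, ?_, HT, fun p _ => G0 p, bal, Gmono, ?_, ac⟩, ?_, ?_⟩
  · intro p t
    by_cases hp : p ∈ M.E
    · show G p t ∈ _
      rw [Gcl]
      constructor
      · have := Gmono p hp 0 z0 _ (clmem t) (clmem t).1
        rwa [G0] at this
      · have h1 := Gmono p hp _ (clmem t) T zT (clmem t).2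
        have h2 := ac p hp 1 zero_le_one 0 z0 T zT hT.le
        rw [G0, H0] at h2
        have h3 := Hle p hp
        have h4 : (Real.exp 1 - 1) * M.Cb * (T - 0) ≤ 2 * |M.Cb| * T := by
          have e3 := Real.exp_one_lt_three
          have e4 := Real.add_one_le_exp 1
          rw [sub_zero]
          refine mul_le_mul_of_nonneg_right ?_ hT.le
          calc (Real.exp 1 - 1) * M.Cb ≤ (Real.exp 1 - 1) * |M.Cb| :=
                mul_le_mul_of_nonneg_left (le_abs_self _) (by linarith)
            _ ≤ _ := mul_le_mul_of_nonneg_right (by linarith) (abs_nonneg _)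
        linarith
    · simp only [hG, hp, if_false]
      exact ⟨le_rfl, by positivity⟩
  · intro p t
    by_cases hp : p ∈ M.E
    · show H p t ∈ _
      rw [Hcl]
      constructor
      · have := Hmono p hp 0 z0 _ (clmem t) (clmem t).1
        rwa [H0] at this
      · exact (Hmono p hp _ (clmem t) T zT (clmem t).2).trans (Hle p hp)
    · simp only [hH, hp, if_false]
      exact ⟨le_rfl, hk0.le⟩
  · intro p hp θ s hs t ht hst
    show θ * (G p t - G p s) - ((Real.exp θ - 1) * a p s +
      |Real.exp θ - 1| * ((|M.Cb| + K) * ∑ q ∈ M.E, (G q t - G q s))) * (t - s) ≤ H p t - H p s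
    set D := ∑ q ∈ M.E, (G q t - G q s) with hD
    set c0 := (Real.exp θ - 1) * a p s + |Real.exp θ - 1| * ((|M.Cb| + K) * D) with hc0
    have hdist : ∀ u ∈ Icc s t, dist (m u) (m s) ≤ D := by
      intro u hu
      have hu' : u ∈ Icc 0 T := ⟨hs.1.trans hu.1, hu.2.trans ht.2⟩
      rw [dist_pi_le_iff (Finset.sum_nonneg fun q hq => sub_nonneg.2 (Gmono q hq s hs t ht hst))]
      intro i
      rw [Real.dist_eq, bal u hu' i, bal s hs i]
      have e : m 0 i + ∑ q ∈ M.E, G q u * inc q i - (m 0 i + ∑ q ∈ M.E, G q s * inc q i) =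
          ∑ q ∈ M.E, (G q u - G q s) * inc q i := by
        simp only [sub_mul, Finset.sum_sub_distrib]; ring
      rw [e]
      refine (Finset.abs_sum_le_sum_abs _ _).trans (Finset.sum_le_sum fun q hq => ?_)
      rw [abs_mul, abs_of_nonneg (sub_nonneg.2 (Gmono q hq s hs u hu' hu.1))]
      have h1 := Gmono q hq u hu' t ht hu.2
      have h2 := Gmono q hq s hs u hu' hu.1
      have h3 := mul_le_mul_of_nonneg_left (abs_inc_le q i) (sub_nonneg.2 h2)
      linarith
    rw [Ginc p hp s hs t ht, Hinc p hp s hs t ht, ← intervalIntegral.integral_const_mul]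
    have e : c0 * (t - s) = ∫ _ in s..t, c0 := by simp [mul_comm]
    rw [e, ← intervalIntegral.integral_sub ((gII p hp s hs t ht).const_mul θ) (by simp)]
    refine intervalIntegral.integral_mono_on hst
      (((gII p hp s hs t ht).const_mul θ).sub (by simp)) (hII p hp s hs t ht) fun u hu => ?_
    have h1 := young p hp θ u
    have h2 := he.a_lip hp (mmem u) (mmem s)
    have h3 : |a p u - a p s| ≤ (|M.Cb| + K) * D :=
      h2.trans (mul_le_mul_of_nonneg_left (hdist u hu) (by positivity))
    have h4 : (Real.exp θ - 1) * (a p u - a p s) ≤ |Real.exp θ - 1| * ((|M.Cb| + K) * D) := by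
      refine (le_abs_self _).trans ?_
      rw [abs_mul]
      exact mul_le_mul_of_nonneg_left h3 (abs_nonneg _)
    rw [hc0]
    linarith
  · exact meq 0 z0
  · exact meq T zT

/-! ### From the relaxed formulation back to controlled paths -/

lemma deriv_young {r : ℕ} {M : MeanFieldModel r} {lt} {C T k : ℝ} {x : PathSp r}
    (hx : Adm M lt C T k x) {t : ℝ} (ht : t ∈ Ioo 0 T)
    (hG : ∀ p ∈ M.E, DifferentiableAt ℝ (x.2.1 p) t)
    (hH : ∀ p ∈ M.E, DifferentiableAt ℝ (x.2.2 p) t) {p} (hp : p ∈ M.E) (θ : ℝ) :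
    θ * deriv (x.2.1 p) t - (Real.exp θ - 1) * (x.1 t p.1 * lt p (x.1 t)) ≤
      deriv (x.2.2 p) t := by
  have sG := hasDerivWithinAt_iff_tendsto_slope.1
    ((hG p hp).hasDerivAt.hasDerivWithinAt (s := Ioi t))
  have sH := hasDerivWithinAt_iff_tendsto_slope.1
    ((hH p hp).hasDerivAt.hasDerivWithinAt (s := Ioi t))
  have hs : Ioi t \ {t} = Ioi t := by simp
  rw [hs] at sG sH
  have hc : Tendsto (fun u => C * ∑ q ∈ M.E, (x.2.1 q u - x.2.1 q t)) (nhdsWithin t (Ioi t))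
      (nhds (C * ∑ q ∈ M.E, (x.2.1 q t - x.2.1 q t))) := by
    refine Tendsto.const_mul _ (tendsto_finsetSum _ fun q hq => ?_)
    exact ((hG q hq).continuousAt.tendsto.mono_left nhdsWithin_le_nhds).sub_const _
  have hlim := (sG.const_mul θ).sub ((hc.const_mul |Real.exp θ - 1|).const_add
    ((Real.exp θ - 1) * (x.1 t p.1 * lt p (x.1 t))))
  simp only [sub_self, Finset.sum_const_zero, mul_zero, add_zero] at hlim
  refine le_of_tendsto_of_tendsto hlim sH ?_
  filter_upwards [Ioo_mem_nhdsGT ht.2] with u hu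
  have h1 := hx.loc p hp θ t ⟨ht.1.le, ht.2.le⟩ u ⟨(ht.1.trans hu.1).le, hu.2.le⟩ hu.1.le
  have hpos : 0 < u - t := sub_pos.2 hu.1
  rw [slope_def_field, slope_def_field, le_div_iff₀ hpos, sub_mul]
  refine le_trans (le_of_eq ?_) h1
  field_simp

lemma backward {r : ℕ} {M : MeanFieldModel r} {lt K} (he : RateExt M lt K) {C T k : ℝ} (hT : 0 < T)
    {x : PathSp r} (hx : Adm M lt C T k x) :
    SEnd M T (x.1 0) (x.1 T) ≤ ENNReal.ofReal k := by
  obtain ⟨μ, G, H⟩ := x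
  have hmem : ∀ t, μ t ∈ stdSimplex ℝ (Fin r) := hx.mem
  have hyoung := fun t => deriv_young hx (t := t)
  have z0 : (0 : ℝ) ∈ Icc 0 T := left_mem_Icc.2 hT.le
  have zT : T ∈ Icc 0 T := right_mem_Icc.2 hT.le
  have Gmono : ∀ p ∈ M.E, MonotoneOn (G p) (Icc 0 T) := fun p hp s hs t ht hst =>
    hx.mono p hp s hs t ht hst
  have Hmono : ∀ p ∈ M.E, MonotoneOn (H p) (Icc 0 T) := fun p hp s hs t ht hst => by
    have := hx.loc p hp 0 s hs t ht hst
    simpa using this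
  have Gac : ∀ p ∈ M.E, AbsolutelyContinuousOnInterval (G p) 0 T := fun p hp =>
    ac_of_bound T hT (G p) (H p) M.Cb (Gmono p hp) (Hmono p hp) (hx.ac p hp)
  have μcont : ContinuousOn μ (Icc 0 T) := by
    rw [continuousOn_pi]
    intro i
    have : ContinuousOn (fun t => μ 0 i + ∑ p ∈ M.E, G p t * inc p i) (Icc 0 T) := by
      refine continuousOn_const.add (continuousOn_finsetSum _ fun p hp => ?_)
      have := (Gac p hp).continuousOn
      rw [uIcc_of_le hT.le] at this
      exact this.mul continuousOn_const
    exact this.congr fun t ht => hx.bal t ht i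
  set cl : ℝ → ℝ := fun t => max 0 (min t T) with hcl
  have clmem : ∀ t, cl t ∈ Icc 0 T := fun t => ⟨le_max_left _ _, max_le hT.le (min_le_right _ _)⟩
  have cleq : ∀ t ∈ Icc 0 T, cl t = t := by
    intro t ht
    simp [hcl, ht.1, ht.2]
  have clcont : Continuous cl := by fun_prop
  set m : ℝ → Fin r → ℝ := fun t => μ (cl t) with hm
  have mcont : Continuous m := μcont.comp_continuous clcont clmem
  have meq : ∀ t ∈ Icc 0 T, m t = μ t := fun t ht => by rw [hm]; simp only [cleq t ht]
  set l : ℝ → Fin r → Fin r → ℝ := fun t i j =>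
    if (i, j) ∈ M.E then max (deriv (G (i, j)) t) 0 / m t i else 0 with hl
  set L : ℝ → Fin r → Fin r → ℝ := fun t i j =>
    if i = j then -∑ b ∈ Finset.univ.filter (fun b => b ≠ i), l t i b else l t i j with hLdef
  have hne : ∀ p ∈ M.E, p.1 ≠ p.2 := fun p hp heq => M.no_diag p.1 (by
    have : (p.1, p.1) = p := Prod.ext rfl heq
    rwa [this])
  have lmeas : ∀ i j, Measurable fun t => l t i j := by
    intro i j
    by_cases hp : (i, j) ∈ M.E
    · simp only [hl, hp, if_true]
      exact ((measurable_deriv _).max measurable_const).div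
        ((continuous_apply i).comp mcont).measurable
    · simp only [hl, hp, if_false]
      exact measurable_const
  have hLrate : IsRateMatrix M L := by
    refine ⟨?_, ?_, ?_, ?_⟩
    · intro i j
      by_cases hij : i = j
      · simp only [hLdef, hij, if_true]
        exact (Finset.measurable_sum _ fun b _ => lmeas j b).neg
      · simp only [hLdef, hij, if_false]
        exact lmeas i j
    · intro t i j hij
      simp only [hLdef, hij, if_false, hl]
      split_ifs
      · exact div_nonneg (le_max_right _ _) ((hmem _).1 _)
      · exact le_rfl
    · intro t i j hij hE
      simp only [hLdef, hij, if_false, hl, hE]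
    · intro t i
      simp only [hLdef, if_true]
      congr 1
      refine Finset.sum_congr rfl fun b hb => ?_
      have : i ≠ b := fun h => (Finset.mem_filter.1 hb).2 h.symm
      simp [this]
  have LE : ∀ t ∈ Icc 0 T, ∀ p ∈ M.E, L t p.1 p.2 = max (deriv (G p) t) 0 / μ t p.1 := by
    intro t ht p hp
    simp only [hLdef, hne p hp, if_false, hl, Prod.mk.eta, hp, if_true, meq t ht]
  -- almost everywhere properties
  have hdiff : ∀ F : Fin r × Fin r → ℝ → ℝ, (∀ p ∈ M.E, MonotoneOn (F p) (Icc 0 T)) →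
      ∀ᵐ t, ∀ p ∈ M.E, t ∈ Ioo 0 T → DifferentiableAt ℝ (F p) t := by
    intro F hF
    rw [Finset.eventually_all M.E]
    intro p hp
    filter_upwards [(hF p hp).ae_differentiableWithinAt_of_mem] with t ht htT
    exact (ht ⟨htT.1.le, htT.2.le⟩).differentiableAt (Icc_mem_nhds htT.1 htT.2)
  have hgood : ∀ᵐ t, t ∈ Ioc 0 T → t ∈ Ioo 0 T ∧ (∀ p ∈ M.E, DifferentiableAt ℝ (G p) t) ∧
      ∀ p ∈ M.E, DifferentiableAt ℝ (H p) t := by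
    have hnT : ∀ᵐ t : ℝ, t ≠ T := by simp [ae_iff]
    filter_upwards [hdiff G Gmono, hdiff H Hmono, hnT] with t h1 h2 h3 ht
    have ht' : t ∈ Ioo 0 T := ⟨ht.1, lt_of_le_of_ne ht.2 h3⟩
    exact ⟨ht', fun p hp => h1 p hp ht', fun p hp => h2 p hp ht'⟩
  have key : ∀ᵐ t, t ∈ Ioc 0 T → ∀ p ∈ M.E,
      μ t p.1 * L t p.1 p.2 = deriv (G p) t ∧ 0 ≤ deriv (H p) t ∧
      μ t p.1 * M.lam p.1 p.2 (μ t) * tauStar (L t p.1 p.2 / M.lam p.1 p.2 (μ t) - 1)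
        ≤ deriv (H p) t := by
    filter_upwards [hgood] with t ht htT p hp
    obtain ⟨ht', hGd, hHd⟩ := ht htT
    have htI : t ∈ Icc 0 T := ⟨ht'.1.le, ht'.2.le⟩
    have hy : ∀ θ : ℝ, θ * deriv (G p) t - (Real.exp θ - 1) * (μ t p.1 * lt p (μ t)) ≤
        deriv (H p) t := fun θ => hyoung t ht' hGd hHd hp θ
    have hg0 : 0 ≤ deriv (G p) t := by
      rw [← derivWithin_of_mem_nhds (Icc_mem_nhds ht'.1 ht'.2)]
      exact (Gmono p hp).derivWithin_nonneg
    have hH0 : 0 ≤ deriv (H p) t := by simpa using hy 0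
    rw [LE t htI p hp, max_eq_left hg0, he.eq p hp _ (hmem t)]
    have hpos := (he.pos hp (hmem t)).2.1
    rcases ((hmem t).1 p.1).eq_or_lt with h0 | h0
    · have : deriv (G p) t = 0 := by
        refine tau_dual_zero _ (deriv (H p) t) hg0 fun θ => ?_
        have := hy θ
        rw [← h0] at this
        simpa using this
      rw [← h0, this]
      simp [hH0]
    · refine ⟨by field_simp, hH0, ?_⟩
      have h2 := tau_dual _ _ _ hg0 (mul_pos h0 hpos) hy
      rwa [div_div]
  have hsol : SolvesODE L μ T := by
    have hae : ∀ i, ∀ᵐ t, t ∈ Ioc 0 T → ∑ j, L t j i * μ t j =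
        ∑ p ∈ M.E, deriv (G p) t * inc p i := by
      intro i
      filter_upwards [key] with t ht htT
      rw [flux_id M (L t) (μ t) (hLrate.2.2.1 t) (hLrate.2.2.2 t) i]
      exact Finset.sum_congr rfl fun p hp => by rw [(ht htT p hp).1]
    have hdint : ∀ p ∈ M.E, IntegrableOn (deriv (G p)) (Ioc 0 T) := fun p hp =>
      (intervalIntegrable_iff_integrableOn_Ioc_of_le hT.le).1 (Gac p hp).intervalIntegrable_deriv
    refine ⟨?_, ?_⟩
    · intro i
      rw [integrableOn_Icc_iff_integrableOn_Ioc]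
      have : IntegrableOn (fun t => ∑ p ∈ M.E, deriv (G p) t * inc p i) (Ioc 0 T) :=
        integrable_finsetSum _ fun p hp => (hdint p hp).mul_const _
      refine Integrable.congr this ?_
      have := (ae_restrict_iff' (μ := volume) (measurableSet_Ioc (a := (0 : ℝ)) (b := T))).2 (hae i)
      filter_upwards [this] with t ht using ht.symm
    · intro t ht i
      have h1 := hx.bal t ht i
      simp only at h1
      rw [h1]
      congr 1
      have e1 : ∫ s in Ioc 0 t, ∑ j, L s j i * μ s j =
          ∫ s in Ioc 0 t, ∑ p ∈ M.E, deriv (G p) s * inc p i := by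
        refine setIntegral_congr_ae measurableSet_Ioc ?_
        filter_upwards [hae i] with s hs hst
        exact hs ⟨hst.1, hst.2.trans ht.2⟩
      rw [e1, integral_finsetSum]
      · refine Finset.sum_congr rfl fun p hp => ?_
        rw [integral_mul_const, ← intervalIntegral.integral_of_le ht.1,
          ((Gac p hp).mono (by
            rw [uIcc_of_le hT.le, uIcc_of_le ht.1]
            exact Icc_subset_Icc le_rfl ht.2)).integral_deriv_eq_sub]
        have := hx.G0 p hp
        simp only at this
        rw [this, sub_zero]
      · intro p hp
        exact ((hdint p hp).mono_set (Ioc_subset_Ioc le_rfl ht.2)).mul_const _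
  have hHint : ∀ p ∈ M.E, IntegrableOn (deriv (H p)) (Ioc 0 T) := fun p hp =>
    (intervalIntegrable_iff_integrableOn_Ioc_of_le hT.le).1
      (MonotoneOn.intervalIntegrable_deriv (by rw [uIcc_of_le hT.le]; exact Hmono p hp))
  have hcost : runningCost M μ L T ≤ ENNReal.ofReal k := by
    have keyr := (ae_restrict_iff' (μ := volume)
      (measurableSet_Ioc (a := (0 : ℝ)) (b := T))).2 key
    calc runningCost M μ L T ≤ ∫⁻ t in Ioc 0 T, ENNReal.ofReal (∑ p ∈ M.E, deriv (H p) t) := by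
          unfold runningCost
          refine lintegral_mono_ae ?_
          filter_upwards [keyr] with t ht
          exact ENNReal.ofReal_le_ofReal (Finset.sum_le_sum fun p hp => (ht p hp).2.2)
      _ = ENNReal.ofReal (∫ t in Ioc 0 T, ∑ p ∈ M.E, deriv (H p) t) := by
          rw [ofReal_integral_eq_lintegral_ofReal]
          · exact integrable_finsetSum _ hHint
          · filter_upwards [keyr] with t ht
            exact Finset.sum_nonneg fun p hp => (ht p hp).2.1
      _ ≤ ENNReal.ofReal k := by
          refine ENNReal.ofReal_le_ofReal ?_
          rw [integral_finsetSum _ hHint]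
          refine le_trans (Finset.sum_le_sum fun p hp => ?_) hx.HT
          have hle := Hmono p hp z0 zT hT.le
          have h1 := MonotoneOn.intervalIntegral_deriv_mem_uIcc (f := H p) (a := 0) (b := T)
            (by rw [uIcc_of_le hT.le]; exact Hmono p hp)
          rw [uIcc_of_le (sub_nonneg.2 hle), intervalIntegral.integral_of_le hT.le] at h1
          have h2 := (hx.Hbox p 0).1
          simp only at h2 ⊢
          linarith [h1.2]
  unfold SEnd SPath
  refine (iInf₂_le μ ⟨rfl, rfl⟩).trans ((iInf₂_le L ⟨hLrate, hsol, rfl, fun t _ => hmem t⟩).trans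
    hcost)

/-! ### Lower semicontinuity of `SEnd` -/

lemma SEnd_lt {r : ℕ} {M : MeanFieldModel r} {T : ℝ} {ν ξ : Fin r → ℝ} {b : ℝ≥0∞}
    (h : SEnd M T ν ξ < b) : ∃ μ L, IsRateMatrix M L ∧ SolvesODE L μ T ∧ μ 0 = ν ∧ μ T = ξ ∧
      (∀ t ∈ Icc (0 : ℝ) T, μ t ∈ stdSimplex ℝ (Fin r)) ∧ runningCost M μ L T < b := by
  unfold SEnd SPath at h
  simp only [iInf_lt_iff] at h
  obtain ⟨μ, ⟨h0, h1⟩, L, ⟨h2, h3, h4, h5⟩, h6⟩ := h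
  exact ⟨μ, L, h2, h3, h0, h1, h5, h6⟩

lemma SEnd_lsc {r : ℕ} (M : MeanFieldModel r) {T : ℝ} (hT : 0 < T) {ν ξ : Fin r → ℝ} {k : ℝ}
    (h : ENNReal.ofReal k < SEnd M T ν ξ) :
    ∀ᶠ z : (Fin r → ℝ) × (Fin r → ℝ) in nhds (ν, ξ), ENNReal.ofReal k ≤ SEnd M T z.1 z.2 := by
  obtain ⟨lt, K, he⟩ := exists_ext M
  have hc := adm_closed M lt (fun p => (he.lip p).continuous) (|M.Cb| + K) T k
  have hn : (ν, ξ) ∈ {z : (Fin r → ℝ) × (Fin r → ℝ) |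
      ∃ x, Adm M lt (|M.Cb| + K) T k x ∧ x.1 0 = z.1 ∧ x.1 T = z.2}ᶜ := by
    rintro ⟨x, hx, h0, h1⟩
    have := backward he hT hx
    simp only at h0 h1
    rw [h0, h1] at this
    exact absurd h (not_lt.2 this)
  filter_upwards [hc.isOpen_compl.mem_nhds hn] with z hz
  by_contra! hlt
  obtain ⟨μ, L, h1, h2, h3, h4, h5, h6⟩ := SEnd_lt hlt
  obtain ⟨x, hx, hx0, hx1⟩ := forward he hT h1 h2 h5 h6
  exact hz ⟨x, hx, hx0.trans h3, hx1.trans h4⟩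

/-! ### Perturbation of the initial condition -/

lemma mix_mem {r : ℕ} {m κ : Fin r → ℝ} {ε : ℝ} (h0 : 0 ≤ ε) (h1 : ε ≤ 1)
    (hm : m ∈ stdSimplex ℝ (Fin r)) (hκ : κ ∈ stdSimplex ℝ (Fin r)) :
    (1 - ε) • m + ε • κ ∈ stdSimplex ℝ (Fin r) :=
  convex_stdSimplex ℝ (Fin r) hm hκ (by linarith) h0 (by ring)

lemma mix_dist {r : ℕ} {m κ : Fin r → ℝ} {ε : ℝ} (h0 : 0 ≤ ε)
    (hm : m ∈ stdSimplex ℝ (Fin r)) (hκ : κ ∈ stdSimplex ℝ (Fin r)) :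
    dist ((1 - ε) • m + ε • κ) m ≤ ε := by
  rw [dist_pi_le_iff h0]
  intro i
  rw [Real.dist_eq]
  have e : ((1 - ε) • m + ε • κ) i - m i = ε * (κ i - m i) := by
    simp only [Pi.add_apply, Pi.smul_apply, smul_eq_mul]; ring
  rw [e, abs_mul, abs_of_nonneg h0]
  have : |κ i - m i| ≤ 1 := by
    rw [abs_le]
    have := hm.1 i
    have := hκ.1 i
    have := simplex_le_one hm i
    have := simplex_le_one hκ i
    constructor <;> linarith
  nlinarith

lemma pert_point {r : ℕ} {M : MeanFieldModel r} {lt K} (he : RateExt M lt K) {p} (hp : p ∈ M.E)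
    {m κ : Fin r → ℝ} {ε l : ℝ} (h0 : 0 ≤ ε) (h1 : ε ≤ 1)
    (hm : m ∈ stdSimplex ℝ (Fin r)) (hκ : κ ∈ stdSimplex ℝ (Fin r)) (hl : 0 ≤ l)
    {m' : Fin r → ℝ} (hm' : m' = (1 - ε) • m + ε • κ) :
    m' p.1 * lt p m' * tauStar ((1 - ε) * m p.1 / m' p.1 * l / lt p m' - 1) ≤
      (1 + K / M.c * ε) * (m p.1 * lt p m * tauStar (l / lt p m - 1)) +
        (2 * |M.Cb| * (K / M.c) + 2 * |M.Cb| + K) * ε := by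
  have hm'mem : m' ∈ stdSimplex ℝ (Fin r) := hm' ▸ mix_mem h0 h1 hm hκ
  have hd : dist m' m ≤ ε := hm' ▸ mix_dist h0 hm hκ
  obtain ⟨c1, c2, c3⟩ := he.pos hp hm
  obtain ⟨d1, d2, d3⟩ := he.pos hp hm'mem
  have hc := M.c_pos
  have hi := hm.1 p.1
  have hi1 := simplex_le_one hm p.1
  set h := m p.1 * lt p m * tauStar (l / lt p m - 1) with hh
  have hx : 0 ≤ l / lt p m := div_nonneg hl c2.le
  have hnn : 0 ≤ h := mul_nonneg (mul_nonneg hi c2.le) (tau_nonneg _ hx)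
  have hKc : 0 ≤ K / M.c := div_nonneg K.2 hc.le
  have hCb : M.Cb ≤ |M.Cb| := le_abs_self _
  have hCb0 := abs_nonneg M.Cb
  have hK0 : (0 : ℝ) ≤ K := K.2
  have hge : (1 - ε) * m p.1 ≤ m' p.1 := by
    rw [hm']
    simp only [Pi.add_apply, Pi.smul_apply, smul_eq_mul]
    have := mul_nonneg h0 (hκ.1 p.1)
    linarith
  rcases (hm'mem.1 p.1).eq_or_lt with hz | hz
  · rw [← hz]
    simp only [zero_mul]
    positivity
  · set g := m p.1 * l with hg
    have hg0 : 0 ≤ g := mul_nonneg hi hl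
    have hheq : h = g * Real.log (l / lt p m) - g + m p.1 * lt p m := by
      have := tau_eq l (lt p m) c2
      rw [hh, mul_assoc, this]; ring
    have hgle : g ≤ h + 2 * |M.Cb| := by
      have h2 := mul_le_mul_of_nonneg_left (tau_young _ 1 hx) (mul_nonneg hi c2.le)
      have e : m p.1 * lt p m * (1 * (l / lt p m) - (Real.exp 1 - 1)) =
          g - (Real.exp 1 - 1) * (m p.1 * lt p m) := by
        rw [hg]; field_simp
      rw [e] at h2
      have e3 := Real.exp_one_lt_three
      have hab := he.a_bd hp hm
      have : (Real.exp 1 - 1) * (m p.1 * lt p m) ≤ 2 * |M.Cb| :=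
        mul_le_mul (by linarith) (hab.2.trans hCb) hab.1 (by norm_num)
      linarith
    set l' := (1 - ε) * m p.1 / m' p.1 * l with hl'
    have hml' : m' p.1 * l' = (1 - ε) * g := by
      rw [hl', hg]; field_simp
    have hρ1 : (1 - ε) * m p.1 / m' p.1 ≤ 1 := (div_le_one hz).2 hge
    have hρ0 : 0 ≤ (1 - ε) * m p.1 / m' p.1 :=
      div_nonneg (mul_nonneg (by linarith) hi) hz.le
    have hl'0 : 0 ≤ l' := mul_nonneg hρ0 hl
    have hl'l : l' ≤ l := by
      have := mul_le_mul_of_nonneg_right hρ1 hl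
      linarith
    have hδ : lt p m / lt p m' - 1 ≤ K / M.c * ε := by
      have hlip : |lt p m' - lt p m| ≤ K * ε := by
        rw [← Real.dist_eq]
        exact ((he.lip p).dist_le_mul m' m).trans (mul_le_mul_of_nonneg_left hd hK0)
      have e : lt p m / lt p m' - 1 = (lt p m - lt p m') / lt p m' := by field_simp
      have e2 : K / M.c * ε = (K * ε) / M.c := by ring
      rw [e, e2]
      have := (abs_le.1 hlip).1
      refine div_le_div₀ (by positivity) (by linarith) hc d1
    have hlog : (1 - ε) * g * Real.log (l' / lt p m') ≤
        (1 - ε) * g * (Real.log (l / lt p m) + K / M.c * ε) := by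
      rcases hl'0.eq_or_lt with hlz | hlz
      · have : (1 - ε) * g = 0 := by rw [← hml', ← hlz, mul_zero]
        rw [this]; simp
      · refine mul_le_mul_of_nonneg_left ?_ (mul_nonneg (by linarith) hg0)
        have hlp : 0 < l := hlz.trans_le hl'l
        calc Real.log (l' / lt p m') ≤ Real.log (l / lt p m') :=
              Real.log_le_log (by positivity) (div_le_div_of_nonneg_right hl'l d2.le)
          _ = Real.log (l / lt p m) + Real.log (lt p m / lt p m') := by
              rw [← Real.log_mul (by positivity) (by positivity)]
              congr 1; field_simp
          _ ≤ _ := by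
              have := Real.log_le_sub_one_of_pos (div_pos c2 d2)
              linarith
    have hLHS : m' p.1 * lt p m' * tauStar (l' / lt p m' - 1) =
        (1 - ε) * g * Real.log (l' / lt p m') - (1 - ε) * g + m' p.1 * lt p m' := by
      rw [mul_assoc, tau_eq _ _ d2, ← hml']; ring
    rw [hLHS]
    have ha := (abs_le.1 (he.a_lip hp hm'mem hm)).2
    have ha2 : (|M.Cb| + K) * dist m' m ≤ (|M.Cb| + K) * ε :=
      mul_le_mul_of_nonneg_left hd (by positivity)
    have ha3 : ε * (m p.1 * lt p m) ≤ ε * |M.Cb| :=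
      mul_le_mul_of_nonneg_left ((he.a_bd hp hm).2.trans hCb) h0
    have hgl : g * Real.log (l / lt p m) = h + g - m p.1 * lt p m := by rw [hheq]; ring
    have e1 : (1 - ε) * g * (Real.log (l / lt p m) + K / M.c * ε) =
        (1 - ε) * (h + g - m p.1 * lt p m) + (1 - ε) * g * (K / M.c * ε) := by
      rw [← hgl]; ring
    have hke : 0 ≤ K / M.c * ε := mul_nonneg hKc h0
    have e2 : (1 - ε) * g * (K / M.c * ε) ≤ (h + 2 * |M.Cb|) * (K / M.c * ε) := by
      refine mul_le_mul_of_nonneg_right ?_ hke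
      have := mul_nonneg h0 hg0
      linarith
    have e3 : 0 ≤ ε * h := mul_nonneg h0 hnn
    nlinarith

lemma pert {r : ℕ} {M : MeanFieldModel r} {lt K} (he : RateExt M lt K) {T : ℝ} (hT : 0 < T)
    {ν ξ κ : Fin r → ℝ} {ε s : ℝ} (h0 : 0 ≤ ε) (h1 : ε ≤ 1)
    (hκ : κ ∈ stdSimplex ℝ (Fin r)) (hs0 : 0 ≤ s) (hs : SEnd M T ν ξ < ENNReal.ofReal s) :
    SEnd M T ((1 - ε) • ν + ε • κ) ((1 - ε) • ξ + ε • κ) ≤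
      ENNReal.ofReal ((1 + K / M.c * ε) * s +
        M.E.card * (2 * |M.Cb| * (K / M.c) + 2 * |M.Cb| + K) * ε * T) := by
  obtain ⟨μ, L, hL, hode, hμ0, hμT, hμ, hcost⟩ := SEnd_lt hs
  have hc := M.c_pos
  have hK0 : (0 : ℝ) ≤ K := K.2
  set C2 := 2 * |M.Cb| * (K / M.c) + 2 * |M.Cb| + K with hC2
  have hC2nn : 0 ≤ C2 := by positivity
  set cl : ℝ → ℝ := fun t => max 0 (min t T) with hcl
  have clmem : ∀ t, cl t ∈ Icc 0 T := fun t => ⟨le_max_left _ _, max_le hT.le (min_le_right _ _)⟩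
  have cleq : ∀ t ∈ Icc 0 T, cl t = t := by
    intro t ht
    simp [hcl, ht.1, ht.2]
  have clcont : Continuous cl := by fun_prop
  set m : ℝ → Fin r → ℝ := fun t => μ (cl t) with hm
  have mcont : Continuous m := (ode_continuousOn hode).comp_continuous clcont clmem
  have mmem : ∀ t, m t ∈ stdSimplex ℝ (Fin r) := fun t => hμ _ (clmem t)
  have meq : ∀ t ∈ Icc 0 T, m t = μ t := fun t ht => by rw [hm]; simp only [cleq t ht]
  set m' : ℝ → Fin r → ℝ := fun t => (1 - ε) • m t + ε • κ with hm'
  have m'mem : ∀ t, m' t ∈ stdSimplex ℝ (Fin r) := fun t => mix_mem h0 h1 (mmem t) hκ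
  have m'cont : Continuous m' := by fun_prop
  set L' : ℝ → Fin r → Fin r → ℝ := fun t i j => (1 - ε) * m t i / m' t i * L t i j with hL'
  have hρ0 : ∀ t i, 0 ≤ (1 - ε) * m t i / m' t i := fun t i =>
    div_nonneg (mul_nonneg (by linarith) ((mmem t).1 i)) ((m'mem t).1 i)
  have hge : ∀ t i, (1 - ε) * m t i ≤ m' t i := by
    intro t i
    have := mul_nonneg h0 (hκ.1 i)
    simp only [hm', Pi.add_apply, Pi.smul_apply, smul_eq_mul]
    linarith
  have hρm : ∀ t i, (1 - ε) * m t i / m' t i * m' t i = (1 - ε) * m t i := by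
    intro t i
    rcases ((m'mem t).1 i).eq_or_lt with hz | hz
    · have h2 := hge t i
      have h3 := mul_nonneg (by linarith : 0 ≤ 1 - ε) ((mmem t).1 i)
      rw [← hz] at h2 ⊢
      simp; 
      have := le_antisymm h2 h3
      simpa using this.symm
    · field_simp
  obtain ⟨hL1, hL2, hL3, hL4⟩ := hL
  have hrate : IsRateMatrix M L' := by
    refine ⟨?_, ?_, ?_, ?_⟩
    · intro i j
      exact (((((continuous_apply i).comp mcont).measurable).const_mul (1 - ε)).div
        ((continuous_apply i).comp m'cont).measurable).mul (hL1 i j)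
    · intro t i j hij
      exact mul_nonneg (hρ0 t i) (hL2 t i j hij)
    · intro t i j hij hE
      simp only [hL', hL3 t i j hij hE, mul_zero]
    · intro t i
      simp only [hL']
      rw [hL4 t i, ← Finset.mul_sum, mul_neg]
  have hvel : ∀ t ∈ Icc 0 T, ∀ i, ∑ j, L' t j i * m' t j = (1 - ε) * ∑ j, L t j i * μ t j := by
    intro t ht i
    rw [Finset.mul_sum]
    refine Finset.sum_congr rfl fun j _ => ?_
    have := hρm t j
    simp only [hL']
    rw [← meq t ht]
    calc _ = ((1 - ε) * m t j / m' t j * m' t j) * L t j i := by ring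
      _ = _ := by rw [this]; ring
  have z0 : (0 : ℝ) ∈ Icc 0 T := left_mem_Icc.2 hT.le
  have zT : T ∈ Icc 0 T := right_mem_Icc.2 hT.le
  have hsol : SolvesODE L' m' T := by
    refine ⟨fun i => ?_, fun t ht i => ?_⟩
    · have hI : IntegrableOn (fun t => (1 - ε) * ∑ j, L t j i * μ t j) (Icc 0 T) :=
        (hode.1 i).const_mul (1 - ε)
      exact hI.congr_fun (fun t ht => (hvel t ht i).symm) measurableSet_Icc
    · have e : ∫ u in Ioc 0 t, ∑ j, L' u j i * m' u j =
          ∫ u in Ioc 0 t, (1 - ε) * ∑ j, L u j i * μ u j :=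
        setIntegral_congr_fun measurableSet_Ioc fun u hu =>
          hvel u ⟨hu.1.le, hu.2.trans ht.2⟩ i
      rw [e, integral_const_mul]
      have := hode.2 t ht i
      simp only [hm', Pi.add_apply, Pi.smul_apply, smul_eq_mul, meq t ht, meq 0 z0]
      rw [this]; ring
  have hcost' : runningCost M m' L' T ≤ ENNReal.ofReal ((1 + K / M.c * ε) * s +
        M.E.card * C2 * ε * T) := by
    have hne : ∀ p ∈ M.E, p.1 ≠ p.2 := fun p hp heq => M.no_diag p.1 (by
      have : (p.1, p.1) = p := Prod.ext rfl heq
      rwa [this])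
    have hA : 0 ≤ 1 + K / M.c * ε := by positivity
    calc runningCost M m' L' T ≤ ∫⁻ t in Ioc 0 T, (ENNReal.ofReal (1 + K / M.c * ε) *
          ENNReal.ofReal (∑ p ∈ M.E, μ t p.1 * M.lam p.1 p.2 (μ t) *
            tauStar (L t p.1 p.2 / M.lam p.1 p.2 (μ t) - 1)) +
          ENNReal.ofReal (M.E.card * C2 * ε)) := by
          unfold runningCost
          refine setLIntegral_mono' measurableSet_Ioc fun t ht => ?_
          have ht' : t ∈ Icc 0 T := ⟨ht.1.le, ht.2⟩
          rw [← ENNReal.ofReal_mul hA]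
          refine le_trans (ENNReal.ofReal_le_ofReal ?_) ENNReal.ofReal_add_le
          have e : (M.E.card : ℝ) * C2 * ε = ∑ p ∈ M.E, C2 * ε := by
            rw [Finset.sum_const, nsmul_eq_mul]; ring
          rw [e, Finset.mul_sum, ← Finset.sum_add_distrib]
          refine Finset.sum_le_sum fun p hp => ?_
          rw [he.eq p hp _ (m'mem t), he.eq p hp _ (hμ t ht'), ← meq t ht']
          exact pert_point he hp h0 h1 (mmem t) hκ (hL2 t _ _ (hne p hp)) rfl
      _ = ENNReal.ofReal (1 + K / M.c * ε) * runningCost M μ L T +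
          ENNReal.ofReal (M.E.card * C2 * ε) * ENNReal.ofReal T := by
          rw [lintegral_add_right _ measurable_const, lintegral_const_mul' _ _ ENNReal.ofReal_ne_top]
          simp [runningCost]
      _ ≤ ENNReal.ofReal (1 + K / M.c * ε) * ENNReal.ofReal s +
          ENNReal.ofReal (M.E.card * C2 * ε) * ENNReal.ofReal T := by
          gcongr
      _ = _ := by
          rw [← ENNReal.ofReal_mul hA, ← ENNReal.ofReal_mul (by positivity),
            ← ENNReal.ofReal_add (by positivity) (by positivity)]
  unfold SEnd SPath
  refine (iInf₂_le m' ⟨?_, ?_⟩).trans ((iInf₂_le L' ⟨hrate, hsol, ?_, fun t _ => m'mem t⟩).trans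
    hcost')
  · simp only [hm', meq 0 z0, hμ0]
  · simp only [hm', meq T zT, hμT]
  · simp only [hm', meq 0 z0, hμ0]

lemma exists_mix {r : ℕ} {ν : Fin r → ℝ} (hν : ν ∈ stdSimplex ℝ (Fin r)) {ε : ℝ} (hε : 0 < ε) :
    ∀ᶠ ν' in nhdsWithin ν (stdSimplex ℝ (Fin r)), ∃ κ ∈ stdSimplex ℝ (Fin r),
      ν' = (1 - ε) • ν + ε • κ := by
  have h1 : ∀ i, ∀ᶠ ν' in nhdsWithin ν (stdSimplex ℝ (Fin r)), (1 - ε) * ν i ≤ ν' i := by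
    intro i
    rcases (hν.1 i).eq_or_lt with h | h
    · filter_upwards [self_mem_nhdsWithin] with ν' hν'
      rw [← h, mul_zero]
      exact hν'.1 i
    · have hlt : (1 - ε) * ν i < ν i := by nlinarith
      have : ∀ᶠ ν' in nhds ν, (1 - ε) * ν i < ν' i :=
        (continuous_apply i).continuousAt.eventually (lt_mem_nhds hlt)
      filter_upwards [this.filter_mono nhdsWithin_le_nhds] with ν' h' using h'.le
  filter_upwards [eventually_all.2 h1, self_mem_nhdsWithin] with ν' h2 hν'
  refine ⟨fun i => (ν' i - (1 - ε) * ν i) / ε, ⟨fun i => div_nonneg (sub_nonneg.2 (h2 i)) hε.le, ?_⟩, ?_⟩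
  · rw [← Finset.sum_div, Finset.sum_sub_distrib, ← Finset.mul_sum, hν.2, hν'.2]
    field_simp; ring
  · ext i
    simp only [Pi.add_apply, Pi.smul_apply, smul_eq_mul]
    field_simp; ring

lemma ereal_sub_le {a k c : ℝ} {S : ℝ≥0∞} (h : ENNReal.ofReal k ≤ S) (hc : a - k ≤ c) :
    (a : EReal) - (S : EReal) ≤ (c : EReal) := by
  have h1 : (k : EReal) ≤ (S : EReal) := by
    have h2 : ((ENNReal.ofReal k : ℝ≥0∞) : EReal) ≤ (S : EReal) :=
      EReal.coe_ennreal_le_coe_ennreal_iff.2 h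
    rw [EReal.coe_ennreal_ofReal] at h2
    exact le_trans (EReal.coe_le_coe_iff.2 (le_max_left _ _)) h2
  calc (a : EReal) - (S : EReal) ≤ (a : EReal) - (k : EReal) := EReal.sub_le_sub le_rfl h1
    _ = ((a - k : ℝ) : EReal) := by rw [EReal.coe_sub]
    _ ≤ c := EReal.coe_le_coe_iff.2 hc

lemma ereal_le_sub {a k c : ℝ} {S : ℝ≥0∞} (h0 : 0 ≤ k) (h : S ≤ ENNReal.ofReal k)
    (hc : c ≤ a - k) : (c : EReal) ≤ (a : EReal) - (S : EReal) := by
  have h1 : (S : EReal) ≤ (k : EReal) := by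
    have h2 : (S : EReal) ≤ ((ENNReal.ofReal k : ℝ≥0∞) : EReal) :=
      EReal.coe_ennreal_le_coe_ennreal_iff.2 h
    rwa [EReal.coe_ennreal_ofReal, max_eq_left h0] at h2
  calc (c : EReal) ≤ ((a - k : ℝ) : EReal) := EReal.coe_le_coe_iff.2 hc
    _ = (a : EReal) - (k : EReal) := by rw [EReal.coe_sub]
    _ ≤ (a : EReal) - (S : EReal) := EReal.sub_le_sub le_rfl h1

lemma joint_usc {r : ℕ} (M : MeanFieldModel r) {T : ℝ} (hT : 0 < T)
    {f : (Fin r → ℝ) → ℝ} (hf : ContinuousOn f (stdSimplex ℝ (Fin r)))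
    {ν ξ : Fin r → ℝ} (hξ : ξ ∈ stdSimplex ℝ (Fin r)) {c : EReal}
    (h : (f ξ : EReal) - (SEnd M T ν ξ : EReal) < c) :
    ∀ᶠ z : (Fin r → ℝ) × (Fin r → ℝ) in nhds (ν, ξ), z.2 ∈ stdSimplex ℝ (Fin r) →
      (f z.2 : EReal) - (SEnd M T z.1 z.2 : EReal) < c := by
  obtain ⟨d, hd1, hd2⟩ := EReal.lt_iff_exists_real_btwn.1 h
  have hk : ∃ k : ℝ, f ξ - d < k ∧ ∀ᶠ z : (Fin r → ℝ) × (Fin r → ℝ) in nhds (ν, ξ),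
      ENNReal.ofReal k ≤ SEnd M T z.1 z.2 := by
    by_cases h0 : f ξ - d < 0
    · exact ⟨0, h0, by simp⟩
    · push Not at h0
      have h1 : ENNReal.ofReal (f ξ - d) < SEnd M T ν ξ := by
        by_contra hcon
        push Not at hcon
        have := ereal_le_sub (c := d) (a := f ξ) h0 hcon (by linarith)
        exact absurd hd1 (not_lt.2 this)
      obtain ⟨k, hk0, hk1, hk2⟩ := ENNReal.lt_iff_exists_real_btwn.1 h1
      refine ⟨k, ?_, SEnd_lsc M hT hk2⟩
      exact (ENNReal.ofReal_lt_ofReal_iff_of_nonneg h0).1 hk1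
  obtain ⟨k, hk, hkz⟩ := hk
  have hfe : ∀ᶠ y in nhds ξ, y ∈ stdSimplex ℝ (Fin r) → f y < d + k := by
    have := (hf ξ hξ).eventually (eventually_lt_nhds (show f ξ < d + k by linarith))
    exact eventually_nhdsWithin_iff.1 this
  have hfe2 : ∀ᶠ z : (Fin r → ℝ) × (Fin r → ℝ) in nhds (ν, ξ),
      z.2 ∈ stdSimplex ℝ (Fin r) → f z.2 < d + k :=
    (continuous_snd.tendsto (ν, ξ)).eventually hfe
  filter_upwards [hkz, hfe2] with z h1 h2 h3
  exact lt_of_le_of_lt (ereal_sub_le h1 (by linarith [h2 h3])) hd2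

lemma lam_usc {r : ℕ} (M : MeanFieldModel r) {T : ℝ} (hT : 0 < T)
    {f : (Fin r → ℝ) → ℝ} (hf : ContinuousOn f (stdSimplex ℝ (Fin r)))
    {ν : Fin r → ℝ} {b : EReal}
    (h : (⨆ ξ ∈ stdSimplex ℝ (Fin r), ((f ξ : EReal) - (SEnd M T ν ξ : EReal))) < b) :
    ∀ᶠ ν' in nhds ν,
      (⨆ ξ ∈ stdSimplex ℝ (Fin r), ((f ξ : EReal) - (SEnd M T ν' ξ : EReal))) < b := by
  obtain ⟨c, hc1, hc2⟩ := exists_between h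
  have key : ∀ᶠ ν' in nhds ν, ∀ ξ ∈ stdSimplex ℝ (Fin r), (ξ ∈ stdSimplex ℝ (Fin r) →
      (f ξ : EReal) - (SEnd M T ν' ξ : EReal) < c) := by
    refine (isCompact_stdSimplex ℝ (Fin r)).eventually_forall_of_forall_eventually ?_
    intro ξ hξ
    refine joint_usc M hT hf hξ (lt_of_le_of_lt ?_ hc1)
    exact le_iSup₂ (f := fun ξ (_ : ξ ∈ stdSimplex ℝ (Fin r)) =>
      ((f ξ : EReal) - (SEnd M T ν ξ : EReal))) ξ hξ
  filter_upwards [key] with ν' hν'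
  exact lt_of_le_of_lt (iSup₂_le fun ξ hξ => (hν' ξ hξ hξ).le) hc2

lemma lam_lsc {r : ℕ} (M : MeanFieldModel r) {T : ℝ} (hT : 0 < T)
    {f : (Fin r → ℝ) → ℝ} (hf : ContinuousOn f (stdSimplex ℝ (Fin r)))
    {ν : Fin r → ℝ} (hν : ν ∈ stdSimplex ℝ (Fin r)) {b : EReal}
    (h : b < (⨆ ξ ∈ stdSimplex ℝ (Fin r), ((f ξ : EReal) - (SEnd M T ν ξ : EReal)))) :
    ∀ᶠ ν' in nhdsWithin ν (stdSimplex ℝ (Fin r)),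
      b < (⨆ ξ ∈ stdSimplex ℝ (Fin r), ((f ξ : EReal) - (SEnd M T ν' ξ : EReal))) := by
  simp only [lt_iSup_iff] at h
  obtain ⟨ξ, hξ, h⟩ := h
  obtain ⟨d, hd1, hd2⟩ := EReal.lt_iff_exists_real_btwn.1 h
  have hlt : SEnd M T ν ξ < ENNReal.ofReal (f ξ - d) := by
    by_contra hcon
    push Not at hcon
    exact absurd hd2 (not_lt.2 (ereal_sub_le hcon (by linarith)))
  obtain ⟨s, hs0, hs1, hs2⟩ := ENNReal.lt_iff_exists_real_btwn.1 hlt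
  have hs3 : s < f ξ - d := (ENNReal.ofReal_lt_ofReal_iff_of_nonneg hs0).1 hs2
  obtain ⟨lt, K, he⟩ := exists_ext M
  set g : ℝ → ℝ := fun ε => (1 + K / M.c * ε) * s +
        M.E.card * (2 * |M.Cb| * (K / M.c) + 2 * |M.Cb| + K) * ε * T with hg
  have hgc : Continuous g := by fun_prop
  have hg0 : g 0 = s := by simp [hg]
  set η := f ξ - d - s with hη
  have hηpos : 0 < η := by linarith
  obtain ⟨δ, hδ, hδf⟩ := Metric.continuousWithinAt_iff.1 (hf ξ hξ) (η / 2) (by linarith)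
  have e1 : ∀ᶠ ε in nhdsWithin (0 : ℝ) (Ioi 0), g ε < s + η / 2 := by
    refine nhdsWithin_le_nhds ((hgc.tendsto 0).eventually (eventually_lt_nhds ?_))
    rw [hg0]; linarith
  have e2 : ∀ᶠ ε in nhdsWithin (0 : ℝ) (Ioi 0), ε < min δ 1 :=
    nhdsWithin_le_nhds (eventually_lt_nhds (by positivity))
  obtain ⟨ε, ⟨h1, h2⟩, hε⟩ := ((e1.and e2).and self_mem_nhdsWithin).exists
  have hε0 : 0 < ε := hε
  have hεδ : ε < δ := lt_of_lt_of_le h2 (min_le_left _ _)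
  have hε1 : ε ≤ 1 := (lt_of_lt_of_le h2 (min_le_right _ _)).le
  filter_upwards [exists_mix hν hε0] with ν' ⟨κ, hκ, hν'⟩
  subst hν'
  have hm := mix_mem hε0.le hε1 hξ hκ
  have hp := pert he hT (ν := ν) (ξ := ξ) hε0.le hε1 hκ hs0 hs1
  have hfd := hδf hm (lt_of_le_of_lt (mix_dist hε0.le hξ hκ) hεδ)
  rw [Real.dist_eq, abs_lt] at hfd
  have hp2 : SEnd M T ((1 - ε) • ν + ε • κ) ((1 - ε) • ξ + ε • κ) ≤ ENNReal.ofReal (s + η / 2) :=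
    hp.trans (ENNReal.ofReal_le_ofReal h1.le)
  refine lt_of_lt_of_le (lt_of_lt_of_le hd1 (ereal_le_sub (by linarith) hp2
    (show d ≤ f ((1 - ε) • ξ + ε • κ) - (s + η / 2) by linarith [hfd.1]))) ?_
  exact le_iSup₂ (f := fun ξ' (_ : ξ' ∈ stdSimplex ℝ (Fin r)) =>
      ((f ξ' : EReal) - (SEnd M T ((1 - ε) • ν + ε • κ) ξ' : EReal))) _ hm

/-- for fixed `T > 0` and continuous `f : M₁(Z) → ℝ`, the map
`ν ↦ Λ(f|ν) = sup_{ξ ∈ M₁(Z)} [ f(ξ) − S_T(ξ|ν) ]` (with values in the extended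
reals) is continuous on `M₁(Z)`, and the supremum is attained for each `ν`. -/
theorem stmt15 (r : ℕ) (hr : 0 < r) (M : MeanFieldModel r) (T : ℝ) (hT : 0 < T)
    (f : (Fin r → ℝ) → ℝ) (hf : ContinuousOn f (stdSimplex ℝ (Fin r))) :
    ContinuousOn (fun ν => ⨆ ξ ∈ stdSimplex ℝ (Fin r),
        ((f ξ : EReal) - (SEnd M T ν ξ : EReal))) (stdSimplex ℝ (Fin r)) ∧
    ∀ ν ∈ stdSimplex ℝ (Fin r), ∃ ξ ∈ stdSimplex ℝ (Fin r),
      (⨆ ξ' ∈ stdSimplex ℝ (Fin r), ((f ξ' : EReal) - (SEnd M T ν ξ' : EReal))) =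
        (f ξ : EReal) - (SEnd M T ν ξ : EReal) := by
  refine ⟨fun ν hν => ?_, fun ν hν => ?_⟩
  · refine tendsto_order.2 ⟨fun b hb => lam_lsc M hT hf hν hb, fun b hb => ?_⟩
    exact nhdsWithin_le_nhds (lam_usc M hT hf hb)
  · have hne : (stdSimplex ℝ (Fin r)).Nonempty :=
      ⟨_, single_mem_stdSimplex ℝ (⟨0, hr⟩ : Fin r)⟩
    have husc : UpperSemicontinuousOn
        (fun ξ => (f ξ : EReal) - (SEnd M T ν ξ : EReal)) (stdSimplex ℝ (Fin r)) := by
      intro ξ hξ c hc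
      have h1 := joint_usc M hT hf hξ hc
      have h2 : Tendsto (fun y : Fin r → ℝ => (ν, y)) (nhds ξ) (nhds (ν, ξ)) :=
        (Continuous.prodMk_right ν).tendsto ξ
      exact eventually_nhdsWithin_iff.2 (h2.eventually h1)
    obtain ⟨ξ, hξ, hmax⟩ := husc.exists_isMaxOn hne (isCompact_stdSimplex ℝ (Fin r))
    refine ⟨ξ, hξ, le_antisymm (iSup₂_le fun ξ' hξ' => hmax hξ') ?_⟩
    exact le_iSup₂ (f := fun ξ' (_ : ξ' ∈ stdSimplex ℝ (Fin r)) =>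
      ((f ξ' : EReal) - (SEnd M T ν ξ' : EReal))) ξ hξ
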